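/- arXiv:1509.09210 — 3 statements merged into one kernel-verified Lean document; each statement's English description precedes it below -/
import Mathlib

section
/- For every pair of positive integers k and j, there exists a set of j pairwise non-isomorphic trees all having the same U_k-polynomial. -/
open scoped Classical

/-- The multiset of sizes of the connected components of a finite graph. -/
noncomputable def componentSizes {V : Type} [Fintype V] (H : SimpleGraph V) : Multiset ℕ :=
  (Finset.univ : Finset H.ConnectedComponent).val.map fun c => Nat.card c.supp

/-- The `U_k`-polynomial of a graph, encoded as the multiset of partitions
`λ(E \ A)` over all edge subsets `A` with `|A| ≤ k`.  Two graphs have the same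
`U_k`-polynomial iff these multisets coincide. -/
noncomputable def UkPoly {V : Type} [Fintype V] (G : SimpleGraph V) (k : ℕ) :
    Multiset (Multiset ℕ) :=
  (G.edgeFinset.powerset.filter fun A => A.card ≤ k).val.map fun A =>
    componentSizes (G.deleteEdges ↑A)

/-- The `U`-polynomial of a graph, encoded as the multiset of partitions
`λ(E \ A)` over all edge subsets `A`. -/
noncomputable def UPoly {V : Type} [Fintype V] (G : SimpleGraph V) :
    Multiset (Multiset ℕ) :=
  G.edgeFinset.powerset.val.map fun A => componentSizes (G.deleteEdges ↑A)

/-! ### Component sizes -/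

theorem sum_card_supp {V : Type} [Fintype V] (H : SimpleGraph V) :
    ∑ c : H.ConnectedComponent, Nat.card c.supp = Fintype.card V := by
  simp only [Nat.card_eq_fintype_card]
  rw [← Fintype.card_sigma]
  exact Fintype.card_congr (Equiv.sigmaFiberEquiv H.connectedComponentMk)

/-- The sizes of the components other than that of `r`. -/
noncomputable def otherSizes {V : Type} [Fintype V] (H : SimpleGraph V) (r : V) : Multiset ℕ :=
  ((Finset.univ : Finset H.ConnectedComponent).erase (H.connectedComponentMk r)).val.map
    fun c => Nat.card c.supp

theorem componentSizes_eq_cons {V : Type} [Fintype V] (H : SimpleGraph V) (r : V) :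
    componentSizes H =
      (Fintype.card V - (otherSizes H r).sum) ::ₘ otherSizes H r := by
  have hmem := Finset.mem_univ (H.connectedComponentMk r)
  have hsum := Finset.add_sum_erase Finset.univ
    (fun c : H.ConnectedComponent => Nat.card c.supp) hmem
  rw [sum_card_supp] at hsum
  have hroot : Fintype.card V - (otherSizes H r).sum =
      Nat.card (H.connectedComponentMk r).supp := by
    change _ - Finset.sum _ _ = _
    omega
  rw [hroot, otherSizes, componentSizes,
    ← Multiset.map_cons (fun c : H.ConnectedComponent => Nat.card c.supp),
    Finset.erase_val, Multiset.cons_erase hmem]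

/-! ### Graphs given by a parent function -/

/-- The graph joining every vertex `v ≠ r` to its parent `p v`. -/
def parentGraph {V : Type} (r : V) (p : V → V) : SimpleGraph V :=
  SimpleGraph.fromRel fun x y => x ≠ r ∧ p x = y

section ParentGraph

variable {V : Type} {r : V} {p : V → V} {rank : V → ℕ}

theorem parentGraph_adj (h : ∀ v, v ≠ r → rank (p v) < rank v) {x y : V} :
    (parentGraph r p).Adj x y ↔ (x ≠ r ∧ p x = y) ∨ (y ≠ r ∧ p y = x) := by
  simp only [parentGraph, SimpleGraph.fromRel_adj, and_iff_right_iff_imp]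
  rintro (⟨hx, rfl⟩ | ⟨hy, rfl⟩) he
  · have := h x hx
    rw [← he] at this
    exact lt_irrefl _ this
  · have := h y hy
    rw [he] at this
    exact lt_irrefl _ this

theorem parentGraph_edge_injOn (h : ∀ v, v ≠ r → rank (p v) < rank v) :
    Set.InjOn (fun v => s(v, p v)) {r}ᶜ := by
  intro x hx y hy hxy
  rcases Sym2.eq_iff.1 hxy with ⟨e, -⟩ | ⟨e, e'⟩
  · exact e
  · have h₁ := h x hx
    have h₂ := h y hy
    rw [e'] at h₁
    rw [← e] at h₂
    omega

theorem parentGraph_edgeSet (h : ∀ v, v ≠ r → rank (p v) < rank v) :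
    (parentGraph r p).edgeSet = (fun v => s(v, p v)) '' {r}ᶜ := by
  ext e
  induction e with | _ x y
  simp only [SimpleGraph.mem_edgeSet, parentGraph_adj h, Set.mem_image, Set.mem_compl_iff,
    Set.mem_singleton_iff, Sym2.eq_iff]
  constructor
  · rintro (⟨hx, e⟩ | ⟨hy, e⟩)
    · exact ⟨x, hx, .inl ⟨rfl, e⟩⟩
    · exact ⟨y, hy, .inr ⟨rfl, e⟩⟩
  · rintro ⟨v, hv, ⟨rfl, e⟩ | ⟨rfl, e⟩⟩
    · exact .inl ⟨hv, e⟩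
    · exact .inr ⟨hv, e⟩

theorem parentGraph_card_edgeSet [Fintype V] (h : ∀ v, v ≠ r → rank (p v) < rank v) :
    Nat.card (parentGraph r p).edgeSet + 1 = Nat.card V := by
  rw [parentGraph_edgeSet h, Nat.card_coe_set_eq, (parentGraph_edge_injOn h).ncard_image,
    ← Set.ncard_singleton r, add_comm, Set.ncard_add_ncard_compl]

theorem parentGraph_isTree [Fintype V] (h : ∀ v, v ≠ r → rank (p v) < rank v) :
    (parentGraph r p).IsTree := by
  rw [SimpleGraph.isTree_iff_connected_and_card]
  refine ⟨?_, parentGraph_card_edgeSet h⟩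
  have reach : ∀ m v, rank v = m → (parentGraph r p).Reachable v r := by
    intro m
    induction m using Nat.strong_induction_on with
    | _ m ih =>
      rintro v rfl
      by_cases hv : v = r
      · rw [hv]
      · exact ((parentGraph_adj h).2 (.inl ⟨hv, rfl⟩)).reachable.trans (ih _ (h v hv) _ rfl)
  have : Nonempty V := ⟨r⟩
  exact ⟨fun x y => (reach _ x rfl).trans (reach _ y rfl).symm⟩

/-- Every component avoiding the root is cut off by the parent edge of its topmost vertex, so
deleting the edges in `A` creates at most `|A|` components besides that of the root. -/
theorem parentGraph_card_otherSizes_le [Fintype V] (h : ∀ v, v ≠ r → rank (p v) < rank v)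
    (A : Finset (Sym2 V)) :
    (otherSizes ((parentGraph r p).deleteEdges ↑A) r).card ≤ A.card := by
  set H := (parentGraph r p).deleteEdges (A : Set (Sym2 V)) with hH
  have top : ∀ c : H.ConnectedComponent, ∃ v, H.connectedComponentMk v = c ∧
      ∀ w, H.connectedComponentMk w = c → rank v ≤ rank w := by
    intro c
    obtain ⟨v₀, hv₀⟩ := c.exists_rep
    obtain ⟨v, hv, hmin⟩ := Finset.exists_min_image
      (Finset.univ.filter fun v => H.connectedComponentMk v = c) rank
      ⟨v₀, Finset.mem_filter.2 ⟨Finset.mem_univ _, hv₀⟩⟩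
    exact ⟨v, by simpa using hv, fun w hw => hmin w (by simpa using hw)⟩
  choose t ht hmin using top
  have hr : ∀ c, c ≠ H.connectedComponentMk r → t c ≠ r := by
    intro c hc e
    exact hc (by rw [← ht c, e])
  rw [otherSizes, Multiset.card_map]
  refine Finset.card_le_card_of_injOn (fun c => s(t c, p (t c))) ?_ ?_
  · intro c hc
    have hc' := hr c (by simpa using hc)
    by_contra hA
    have adj : H.Adj (t c) (p (t c)) := by
      rw [hH, SimpleGraph.deleteEdges_adj]
      exact ⟨(parentGraph_adj h).2 (.inl ⟨hc', rfl⟩), hA⟩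
    have := hmin c (p (t c)) (by
      rw [← ht c, SimpleGraph.ConnectedComponent.eq, ht c]
      exact adj.symm.reachable)
    exact absurd (h _ hc') (not_lt.2 this)
  · intro c hc d hd e
    have := parentGraph_edge_injOn h (hr c (by simpa using hc)) (hr d (by simpa using hd)) e
    rw [← ht c, ← ht d, this]

end ParentGraph

/-! ### Counting -/

theorem card_le_of_multiset_code {γ β : Type} (P : Finset γ) (S : Finset β) (k : ℕ)
    (g : Multiset β → γ)
    (hP : ∀ x ∈ P, ∃ m : Multiset β, m.card ≤ k ∧ (∀ b ∈ m, b ∈ S) ∧ g m = x) :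
    P.card ≤ (S.card + 1) ^ k := by
  have hP' : ∀ x : P, ∃ l : List S, l.length ≤ k ∧ g (l.map Subtype.val : List β) = x := by
    rintro ⟨x, hx⟩
    obtain ⟨m, hm, hS, rfl⟩ := hP x hx
    induction m using Quotient.inductionOn with | _ l
    exact ⟨l.attach.map fun b => ⟨b.1, hS b.1 b.2⟩, by simpa using hm, by
      simp [Function.comp_def]⟩
  choose l hl hg using hP'
  have inj : Function.Injective fun (x : P) (i : Fin k) => (l x)[(i : ℕ)]? := by
    intro x y hxy
    have : l x = l y := by
      refine List.ext_getElem? fun i => ?_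
      by_cases hi : i < k
      · exact congrFun hxy ⟨i, hi⟩
      · rw [List.getElem?_eq_none ((hl x).trans (not_lt.1 hi)),
          List.getElem?_eq_none ((hl y).trans (not_lt.1 hi))]
    exact Subtype.ext (by rw [← hg x, ← hg y, this])
  simpa using Fintype.card_le_of_injective _ inj

/-- Pigeonhole principle for multisets of bounded cardinality over a finite set. -/
theorem exists_embedding_of_multiset_values {F γ : Type} [Fintype F] (U : F → Multiset γ)
    (P : Finset γ) (M j : ℕ) (hP : ∀ f, ∀ x ∈ U f, x ∈ P) (hM : ∀ f, (U f).card ≤ M)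
    (hcard : (M + 1) ^ P.card * j ≤ Fintype.card F) :
    ∃ e : Fin j ↪ F, ∀ i i', U (e i) = U (e i') := by
  let cnt : F → P → Fin (M + 1) := fun f x =>
    ⟨(U f).count x.1, Nat.lt_succ_of_le ((Multiset.count_le_card _ _).trans (hM f))⟩
  obtain ⟨y, hy⟩ := Fintype.exists_le_card_fiber_of_mul_le_card cnt (n := j) (by simpa using hcard)
  obtain ⟨e⟩ : Nonempty (Fin j ↪ {f // f ∈ Finset.univ.filter fun f => cnt f = y}) :=
    Function.Embedding.nonempty_of_card_le (by rwa [Fintype.card_fin, Fintype.card_coe])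
  refine ⟨e.trans (Function.Embedding.subtype _), fun i i' => ?_⟩
  have hcnt : cnt (e i) = cnt (e i') := by
    rw [(Finset.mem_filter.1 (e i).2).2, (Finset.mem_filter.1 (e i').2).2]
  ext x
  by_cases hx : x ∈ P
  · exact congrArg Fin.val (congrFun hcnt ⟨x, hx⟩)
  · rw [Multiset.count_eq_zero_of_notMem fun h => hx (hP _ _ h),
      Multiset.count_eq_zero_of_notMem fun h => hx (hP _ _ h)]

theorem exists_polynomial_le_two_pow (k : ℕ) :
    ∃ n : ℕ, k * (n * n + n + 3) ^ k + 2 ≤ 2 ^ n := by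
  have h₁ := isLittleO_pow_const_const_pow_of_one_lt (R := ℝ) (2 * k + 1) (r := 2) (by norm_num)
  have h₂ := (h₁.def one_pos).and (Filter.eventually_ge_atTop (k * 3 ^ k + 2 + 2))
  obtain ⟨n, hn, hkn⟩ := h₂.exists
  have hn' : n ^ (2 * k + 1) ≤ 2 ^ n := by
    have : (n : ℝ) ^ (2 * k + 1) ≤ 2 ^ n := by simpa using hn
    exact_mod_cast this
  refine ⟨n, le_trans ?_ hn'⟩
  have hn₂ : 2 ≤ n := by omega
  have hpoly : n * n + n + 3 ≤ 3 * n ^ 2 := by nlinarith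
  have hpos : 1 ≤ n ^ (2 * k) := Nat.one_le_pow _ _ (by omega)
  calc k * (n * n + n + 3) ^ k + 2 ≤ k * (3 * n ^ 2) ^ k + 2 * n ^ (2 * k) := by gcongr; omega
    _ = (k * 3 ^ k + 2) * n ^ (2 * k) := by rw [mul_pow, ← pow_mul]; ring
    _ ≤ n * n ^ (2 * k) := by gcongr; omega
    _ = n ^ (2 * k + 1) := by ring

/-! ### Trees assembled from branches -/

/-- The non-root vertices of one branch: its top vertex `none`, the children `some (i, none)` of
the top vertex, and the vertices `some (i, some l)`, which are leaves of the tree. -/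
abbrev Branch (n : ℕ) : Type := Option (Fin n × Option (Fin n))

theorem card_branch (n : ℕ) : Fintype.card (Branch n) = n * n + n + 1 := by
  simp [Branch]
  ring

/-- The parent function of the tree with root `none` whose branch with index `a` has type `S a`:
for `i ∈ S a` the child `(i, none)` of the top vertex of this branch carries exactly `i + 1`
leaves, for `i ∉ S a` it carries none, and all remaining leaves hang from the top vertex. -/
noncomputable def branchParent {n : ℕ} {I : Type} (S : I → Finset (Fin n)) :
    Option (I × Branch n) → Option (I × Branch n)
  | none => none
  | some (_, none) => none
  | some (a, some (_, none)) => some (a, none)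
  | some (a, some (i, some l)) =>
      if i ∈ S a ∧ l ≤ i then some (a, some (i, none)) else some (a, none)

/-- The distance to the root, up to an overestimate for some leaves. -/
def branchRank {n : ℕ} {I : Type} : Option (I × Branch n) → ℕ
  | none => 0
  | some (_, none) => 1
  | some (_, some (_, none)) => 2
  | some (_, some (_, some _)) => 3

section BranchTree

variable {n : ℕ} {I : Type} {S : I → Finset (Fin n)}

theorem branchRank_branchParent_lt (S : I → Finset (Fin n)) (v : Option (I × Branch n))
    (hv : v ≠ none) : branchRank (branchParent S v) < branchRank v := by
  match v, hv with
  | some (a, none), _ => simp [branchParent, branchRank]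
  | some (a, some (i, none)), _ => simp [branchParent, branchRank]
  | some (a, some (i, some l)), _ =>
    simp only [branchParent]
    split_ifs <;> simp [branchRank]

/-- The tree with root `none` whose branch with index `a` has type `S a`. -/
noncomputable def branchTree (S : I → Finset (Fin n)) : SimpleGraph (Option (I × Branch n)) :=
  parentGraph none (branchParent S)

theorem branchTree_adj {x y : Option (I × Branch n)} :
    (branchTree S).Adj x y ↔
      (x ≠ none ∧ branchParent S x = y) ∨ (y ≠ none ∧ branchParent S y = x) :=
  parentGraph_adj (branchRank_branchParent_lt S)

theorem branchTree_adj_none {y : Option (I × Branch n)} :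
    (branchTree S).Adj none y ↔ ∃ a, y = some (a, none) := by
  rw [branchTree_adj]
  match y with
  | none => simp
  | some (a, none) => simp [branchParent]
  | some (a, some (i, none)) => simp [branchParent]
  | some (a, some (i, some l)) =>
    simp only [branchParent]
    split_ifs <;> simp

theorem branchTree_adj_some {a b : I} {x y : Branch n}
    (h : (branchTree S).Adj (some (a, x)) (some (b, y))) : a = b := by
  have key : ∀ (a b : I) (x y : Branch n), branchParent S (some (a, x)) = some (b, y) → a = b := by
    intro a b x y h
    match x with
    | none => simp [branchParent] at h
    | some (i, none) =>
      simp only [branchParent, Option.some.injEq, Prod.mk.injEq] at h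
      exact h.1
    | some (i, some l) =>
      simp only [branchParent] at h
      split_ifs at h <;> simp only [Option.some.injEq, Prod.mk.injEq] at h <;> exact h.1
  rcases branchTree_adj.1 h with ⟨-, h⟩ | ⟨-, h⟩
  · exact key _ _ _ _ h
  · exact (key _ _ _ _ h).symm

/-- In a subgraph, a component avoiding the root lies within a single branch. -/
theorem card_supp_le_of_le_branchTree [Fintype I] {H : SimpleGraph (Option (I × Branch n))}
    (hH : H ≤ branchTree S) (c : H.ConnectedComponent) (hc : c ≠ H.connectedComponentMk none) :
    Nat.card c.supp ≤ n * n + n + 1 := by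
  induction c using SimpleGraph.ConnectedComponent.ind with | _ v
  obtain _ | ⟨a, x⟩ := v
  · exact absurd rfl hc
  have sub : (H.connectedComponentMk (some (a, x))).supp ⊆
      Set.range fun y : Branch n => some (a, y) := by
    intro w hw
    have hreach : Relation.ReflTransGen H.Adj (some (a, x)) w := by
      rw [← SimpleGraph.reachable_iff_reflTransGen]
      exact (SimpleGraph.ConnectedComponent.exact hw).symm
    clear hw
    induction hreach with
    | refl => exact ⟨x, rfl⟩
    | @tail w w' hw hadj ih =>
      have hr : H.Reachable (some (a, x)) w' :=
        (SimpleGraph.reachable_iff_reflTransGen _ _).2 (hw.tail hadj)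
      obtain ⟨y, rfl⟩ := ih
      obtain _ | ⟨b, z⟩ := w'
      · exact absurd (SimpleGraph.ConnectedComponent.sound hr) hc
      · obtain rfl := branchTree_adj_some (hH hadj)
        exact ⟨z, rfl⟩
  calc Nat.card _ ≤ Nat.card (Set.range fun y : Branch n => some (a, y)) :=
        Nat.card_mono (Set.toFinite _) sub
    _ ≤ Nat.card (Branch n) := Finite.card_range_le _
    _ = n * n + n + 1 := by rw [Nat.card_eq_fintype_card, card_branch]

theorem card_neighborSet_none (S : I → Finset (Fin n)) :
    Nat.card ((branchTree S).neighborSet none) = Nat.card I := by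
  have : (branchTree S).neighborSet none = Set.range fun a : I => some (a, (none : Branch n)) := by
    ext y
    simp only [SimpleGraph.mem_neighborSet, branchTree_adj_none, Set.mem_range, eq_comm]
  rw [this]
  exact Nat.card_range_of_injective fun a b h => by simpa using h

theorem card_neighborSet_some_le (a : I) (x : Branch n) :
    Nat.card ((branchTree S).neighborSet (some (a, x))) ≤ n * n + n + 2 := by
  have sub : (branchTree S).neighborSet (some (a, x)) ⊆
      Set.range fun y : Option (Branch n) => y.map fun z => (a, z) := by
    rintro (_ | ⟨b, y⟩) hy
    · exact ⟨none, rfl⟩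
    · obtain rfl := branchTree_adj_some hy
      exact ⟨some y, rfl⟩
  calc Nat.card _ ≤ Nat.card (Set.range fun y : Option (Branch n) => y.map fun z => (a, z)) :=
        Nat.card_mono (Set.toFinite _) sub
    _ ≤ Nat.card (Option (Branch n)) := Finite.card_range_le _
    _ = n * n + n + 2 := by rw [Nat.card_eq_fintype_card, Fintype.card_option, card_branch]

theorem card_neighborSet_child (a : I) (i : Fin n) :
    Nat.card ((branchTree S).neighborSet (some (a, some (i, none)))) =
      if i ∈ S a then (i : ℕ) + 2 else 1 := by
  split_ifs with hi
  · have : (branchTree S).neighborSet (some (a, some (i, none))) =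
        insert (some (a, none)) ((fun l => some (a, some (i, some l))) '' Set.Iic i) := by
      ext y
      rw [SimpleGraph.mem_neighborSet, branchTree_adj]
      match y with
      | none => simp [branchParent]
      | some (b, none) => simp [branchParent, eq_comm]
      | some (b, some (i', none)) => simp [branchParent]
      | some (b, some (i', some l)) =>
        simp only [branchParent]
        split_ifs with h <;> simp <;> grind
    rw [this, Nat.card_coe_set_eq, Set.ncard_insert_of_notMem (by simp),
      Set.ncard_image_of_injective _ (fun l l' h => by simpa using h)]
    simp [Set.ncard_eq_toFinset_card']
  · have : (branchTree S).neighborSet (some (a, some (i, none))) = {some (a, none)} := by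
      ext y
      rw [SimpleGraph.mem_neighborSet, branchTree_adj]
      match y with
      | none => simp [branchParent]
      | some (b, none) => simp [branchParent, eq_comm]
      | some (b, some (i', none)) => simp [branchParent]
      | some (b, some (i', some l)) =>
        simp only [branchParent]
        split_ifs with h <;> simp
        grind
    rw [this]
    simp

theorem card_neighborSet_leaf (a : I) (i l : Fin n) :
    Nat.card ((branchTree S).neighborSet (some (a, some (i, some l)))) = 1 := by
  have : (branchTree S).neighborSet (some (a, some (i, some l))) =
      {branchParent S (some (a, some (i, some l)))} := by
    ext y
    rw [SimpleGraph.mem_neighborSet, branchTree_adj, Set.mem_singleton_iff]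
    match y with
    | none => simp [branchParent, eq_comm]
    | some (b, none) => simp [branchParent, eq_comm]
    | some (b, some (i', none)) => simp [branchParent, eq_comm]
    | some (b, some (i', some l')) =>
      simp only [branchParent]
      split_ifs with h <;> simp [eq_comm]
  rw [this]
  simp

/-- The type of a branch can be read off from the degrees of the neighbours of its top vertex. -/
theorem mem_type_iff (a : I) (i : Fin n) :
    i ∈ S a ↔ ∃ c, (branchTree S).Adj (some (a, none)) c ∧ c ≠ none ∧
      Nat.card ((branchTree S).neighborSet c) = i + 2 := by
  constructor
  · intro hi
    refine ⟨some (a, some (i, none)), branchTree_adj.2 (.inr ⟨by simp, rfl⟩), by simp, ?_⟩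
    rw [card_neighborSet_child, if_pos hi]
  · rintro ⟨c, hadj, hc, hcard⟩
    match c with
    | none => exact absurd rfl hc
    | some (b, none) =>
      simp [branchTree_adj, branchParent] at hadj
    | some (b, some (i', none)) =>
      obtain rfl := branchTree_adj_some hadj
      rw [card_neighborSet_child] at hcard
      split_ifs at hcard with hi'
      · rwa [show i = i' from Fin.ext (by omega)]
      · omega
    | some (b, some (i', some l)) =>
      rw [card_neighborSet_leaf] at hcard
      omega

theorem card_neighborSet_iso {V W : Type} {G : SimpleGraph V} {H : SimpleGraph W} (φ : G ≃g H)
    (v : V) : Nat.card (H.neighborSet (φ v)) = Nat.card (G.neighborSet v) :=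
  (Nat.card_congr (φ.mapNeighborSet v)).symm

variable [Fintype I] {S' : I → Finset (Fin n)}

theorem iso_none (hI : n * n + n + 2 < Fintype.card I) (φ : branchTree S ≃g branchTree S') :
    φ none = none := by
  have h := card_neighborSet_iso φ none
  rw [card_neighborSet_none, Nat.card_eq_fintype_card (α := I)] at h
  rcases hφ : φ none with _ | ⟨a, x⟩
  · rfl
  · rw [hφ] at h
    have := card_neighborSet_some_le (S := S') a x
    omega

theorem card_type_le_of_iso (hI : n * n + n + 2 < Fintype.card I)
    (φ : branchTree S ≃g branchTree S') (τ : Finset (Fin n)) :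
    (Finset.univ.filter fun a => S a = τ).card ≤ (Finset.univ.filter fun a => S' a = τ).card := by
  have hσ : ∀ a, ∃ b, φ (some (a, none)) = some (b, none) := by
    intro a
    rw [← branchTree_adj_none (S := S'), ← iso_none hI φ, φ.map_adj_iff, branchTree_adj_none]
    exact ⟨a, rfl⟩
  choose σ hσ using hσ
  have hS : ∀ a, S' (σ a) = S a := by
    intro a
    ext i
    rw [mem_type_iff, mem_type_iff, ← hσ]
    constructor
    · rintro ⟨c, hadj, hc, hcard⟩
      obtain ⟨c, rfl⟩ := φ.surjective c
      refine ⟨c, φ.map_adj_iff.1 hadj, ?_, by rwa [card_neighborSet_iso] at hcard⟩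
      rintro rfl
      exact hc (iso_none hI φ)
    · rintro ⟨c, hadj, hc, hcard⟩
      refine ⟨φ c, φ.map_adj_iff.2 hadj, ?_, by rwa [card_neighborSet_iso]⟩
      rw [← iso_none hI φ]
      exact φ.injective.ne hc
  refine Finset.card_le_card_of_injOn σ ?_ ?_
  · intro a ha
    simpa [hS] using ha
  · intro a _ b _ h
    have := hσ a
    rw [h, ← hσ b] at this
    simpa using φ.injective this

theorem card_type_eq_of_iso (hI : n * n + n + 2 < Fintype.card I)
    (φ : branchTree S ≃g branchTree S') (τ : Finset (Fin n)) :
    (Finset.univ.filter fun a => S a = τ).card = (Finset.univ.filter fun a => S' a = τ).card :=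
  le_antisymm (card_type_le_of_iso hI φ τ) (card_type_le_of_iso hI φ.symm τ)

/-- `UkPoly` as the image of a finite set of finite edge sets. -/
theorem UkPoly_eq_map {V : Type} [Fintype V] (G : SimpleGraph V) (k : ℕ) :
    UkPoly G k = (G.edgeFinset.powerset.filter fun A => A.card ≤ k).val.map
      fun A : Finset (Sym2 V) => componentSizes (G.deleteEdges ↑A) := by
  simp [UkPoly, Multiset.bind_def, Multiset.pure_def, Multiset.bind_singleton]

/-- Every partition counted by `UkPoly` is determined by the sizes of at most `k` components, each
within one branch. -/
theorem exists_code_of_mem_UkPoly {k : ℕ} {x : Multiset ℕ} (hx : x ∈ UkPoly (branchTree S) k) :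
    ∃ m : Multiset ℕ, m.card ≤ k ∧ (∀ b ∈ m, b ∈ Finset.range (n * n + n + 2)) ∧
      (Fintype.card (Option (I × Branch n)) - m.sum) ::ₘ m = x := by
  rw [UkPoly_eq_map] at hx
  obtain ⟨A, hA, rfl⟩ := Multiset.mem_map.1 hx
  refine ⟨otherSizes ((branchTree S).deleteEdges ↑A) none, ?_, ?_,
    (componentSizes_eq_cons _ _).symm⟩
  · exact (parentGraph_card_otherSizes_le (branchRank_branchParent_lt S) A).trans
      (Finset.mem_filter.1 hA).2
  · intro b hb
    obtain ⟨c, hc, rfl⟩ := Multiset.mem_map.1 hb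
    rw [Finset.mem_range, Nat.lt_succ_iff]
    exact card_supp_le_of_le_branchTree (SimpleGraph.deleteEdges_le _) c (Finset.mem_erase.1 hc).1

theorem card_UkPoly_le {k : ℕ} :
    (UkPoly (branchTree S) k).card ≤ (Fintype.card I * (n * n + n + 1) + 1) ^ k := by
  have hedge : (branchTree S).edgeFinset.card = Fintype.card I * (n * n + n + 1) := by
    have := parentGraph_card_edgeSet (branchRank_branchParent_lt S)
    rw [Nat.card_eq_fintype_card, Nat.card_eq_fintype_card, Fintype.card_option,
      Fintype.card_prod, card_branch] at this
    rw [← SimpleGraph.edgeFinset_card] at this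
    exact Nat.succ_injective this
  rw [UkPoly_eq_map, Multiset.card_map, ← hedge]
  refine card_le_of_multiset_code _ (branchTree S).edgeFinset k (fun m => m.toFinset) fun A hA => ?_
  obtain ⟨hA, hk⟩ := Finset.mem_filter.1 hA
  exact ⟨A.val, hk, fun b hb => Finset.mem_powerset.1 hA hb, Finset.val_toFinset A⟩

end BranchTree

/-! ### The family of trees -/

/-- The assignment of branch types in which each nonempty type `x` occurs `f x` times. -/
noncomputable def typeAssignment {n q : ℕ} (f : {x : Finset (Fin n) // x.Nonempty} → Fin q)
    (a : {x : Finset (Fin n) // x.Nonempty} × Fin q) : Finset (Fin n) :=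
  if a.2 < f a.1 then a.1 else ∅

theorem card_typeAssignment_eq {n q : ℕ} (f : {x : Finset (Fin n) // x.Nonempty} → Fin q)
    (x : {x : Finset (Fin n) // x.Nonempty}) :
    (Finset.univ.filter fun a => typeAssignment f a = x).card = f x := by
  have : (Finset.univ.filter fun a => typeAssignment f a = x) =
      (Finset.Iio (f x)).image fun t => (x, t) := by
    ext ⟨y, t⟩
    have hx := x.2.ne_empty.symm
    simp only [Finset.mem_filter, Finset.mem_univ, true_and, Finset.mem_image, Finset.mem_Iio,
      Prod.mk.injEq]
    rw [typeAssignment]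
    split_ifs with h
    · rw [Subtype.coe_inj]
      constructor
      · rintro rfl
        exact ⟨t, h, rfl, rfl⟩
      · rintro ⟨_, _, rfl, _⟩
        rfl
    · refine ⟨fun e => absurd e hx, ?_⟩
      rintro ⟨_, ht, rfl, rfl⟩
      exact absurd ht h
  rw [this, Finset.card_image_of_injective _ fun t t' h => by simpa using h, Fin.card_Iio]

/-- For every pair of positive integers `k` and `j` there exist `j` pairwise
non-isomorphic trees all having the same `U_k`-polynomial. -/
theorem exists_nonisomorphic_trees_same_Uk (k j : ℕ) (hk : 0 < k) (hj : 0 < j) :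
    ∃ (V : Type) (_ : Fintype V) (T : Fin j → SimpleGraph V),
      (∀ i, (T i).IsTree) ∧
      (∀ i i' : Fin j, i ≠ i' → IsEmpty (T i ≃g T i')) ∧
      (∀ i i' : Fin j, UkPoly (T i) k = UkPoly (T i') k) := by
  obtain ⟨n, hn⟩ := exists_polynomial_le_two_pow k
  set s := n * n + n + 1 with hs
  set X := {x : Finset (Fin n) // x.Nonempty}
  set R := Fintype.card X with hR
  set B := (s + 2) ^ k with hB
  set D := 2 * (R * s + 1) with hD
  set q := j * D ^ (k * B) + 1 with hq
  have hRcard : R + 1 = 2 ^ n := by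
    have h := Fintype.card_subtype_compl fun x : Finset (Fin n) => x = ∅
    rw [Fintype.card_subtype_eq, Fintype.card_finset, Fintype.card_fin] at h
    have hR' : R = 2 ^ n - 1 := by
      rw [← h, hR]
      exact Fintype.card_congr
        (Equiv.subtypeEquivRight fun x => Finset.nonempty_iff_ne_empty)
    have := Nat.one_le_two_pow (n := n)
    omega
  have hRB : k * B + 1 ≤ R := by
    have : k * B + 2 ≤ 2 ^ n := hn
    omega
  have hkB : k * B ≠ 0 := (Nat.mul_pos hk (by positivity)).ne'
  have hqD : D < q := by
    have h₁ : D ≤ D ^ (k * B) := Nat.le_self_pow hkB D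
    have h₂ : D ^ (k * B) ≤ j * D ^ (k * B) := Nat.le_mul_of_pos_left _ hj
    omega
  have hI : n * n + n + 2 < Fintype.card (X × Fin q) := by
    rw [Fintype.card_prod, Fintype.card_fin, ← hR]
    have h₁ : s ≤ R * s := Nat.le_mul_of_pos_left _ (by omega)
    have h₂ : q ≤ R * q := Nat.le_mul_of_pos_left _ (by omega)
    omega
  let T : (X → Fin q) → SimpleGraph (Option ((X × Fin q) × Branch n)) := fun f =>
    branchTree (typeAssignment f)
  let P : Finset (Multiset ℕ) := Finset.univ.biUnion fun f => (UkPoly (T f) k).toFinset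
  have hP : P.card ≤ B := by
    have h := card_le_of_multiset_code P (Finset.range (n * n + n + 2)) k
      (fun m => (Fintype.card (Option ((X × Fin q) × Branch n)) - m.sum) ::ₘ m) (by
        intro x hx
        obtain ⟨f, -, hf⟩ := Finset.mem_biUnion.1 hx
        exact exists_code_of_mem_UkPoly (Multiset.mem_toFinset.1 hf))
    rwa [Finset.card_range] at h
  have hvalues : ((R * q * s + 1) ^ k + 1) ≤ (D * q) ^ k := by
    have h₁ : R * q * s + 1 ≤ (R * s + 1) * q := by nlinarith
    have h₂ : 1 ≤ ((R * s + 1) * q) ^ k := Nat.one_le_pow _ _ (by positivity)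
    have h₃ : 2 ≤ 2 ^ k := Nat.le_self_pow hk.ne' 2
    calc (R * q * s + 1) ^ k + 1 ≤ ((R * s + 1) * q) ^ k + ((R * s + 1) * q) ^ k := by gcongr
      _ = 2 * ((R * s + 1) * q) ^ k := by ring
      _ ≤ 2 ^ k * ((R * s + 1) * q) ^ k := by gcongr
      _ = (D * q) ^ k := by rw [← mul_pow, hD, mul_assoc]
  have hcount : ((R * q * s + 1) ^ k + 1) ^ P.card * j ≤ Fintype.card (X → Fin q) := by
    rw [Fintype.card_fun, Fintype.card_fin, ← hR]
    calc ((R * q * s + 1) ^ k + 1) ^ P.card * j ≤ ((R * q * s + 1) ^ k + 1) ^ B * j := by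
          gcongr
          omega
      _ ≤ ((D * q) ^ k) ^ B * j := by gcongr
      _ = q ^ (k * B) * (j * D ^ (k * B)) := by rw [← pow_mul, mul_pow]; ring
      _ ≤ q ^ (k * B) * q := by gcongr; omega
      _ = q ^ (k * B + 1) := (pow_succ _ _).symm
      _ ≤ q ^ R := Nat.pow_le_pow_right (by omega) hRB
  obtain ⟨e, he⟩ := exists_embedding_of_multiset_values (fun f => UkPoly (T f) k) P
    ((R * q * s + 1) ^ k) j
    (fun f x hx => Finset.mem_biUnion.2 ⟨f, Finset.mem_univ _, Multiset.mem_toFinset.2 hx⟩)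
    (fun f => by
      have h := card_UkPoly_le (S := typeAssignment f) (k := k)
      rwa [Fintype.card_prod, Fintype.card_fin] at h) hcount
  refine ⟨_, inferInstance, fun i => T (e i),
    fun i => parentGraph_isTree (branchRank_branchParent_lt _), fun i i' hii' => ⟨fun φ => ?_⟩, he⟩
  refine hii' (e.injective (funext fun x => Fin.ext ?_))
  rw [← card_typeAssignment_eq, ← card_typeAssignment_eq]
  exact card_type_eq_of_iso hI φ x
end

section
/- Let T and T' be two PTE-trees. Then T and T' have the same U-polynomial if and only if they are isomorphic. -/
open scoped Classical

/-- Vertex type for the tree `T(p,s)`: a central vertex, roots `v_1,…,v_n`, and for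
each `i` the extra vertices of `p i` copies of a 4-vertex path and `s i` copies of
a 4-vertex star (3 extra vertices each, the remaining leaf being identified with
the root `v_i`). -/
abbrev Vtx (n : ℕ) (p s : Fin n → ℕ) : Type :=
  Unit ⊕ Fin n ⊕ ((Σ i : Fin n, Fin (p i) × Fin 3) ⊕ (Σ i : Fin n, Fin (s i) × Fin 3))

/-- Edges of `T(p,s)`: the central vertex is joined to each root `v_i`; each copy of
a 4-vertex path hangs from `v_i` as `v_i — x₀ — x₁ — x₂`; each copy of a 4-vertex
star hangs from `v_i` as `v_i — y₀` with extra leaves `y₁, y₂` adjacent to `y₀`. -/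
inductive TRel (n : ℕ) (p s : Fin n → ℕ) : Vtx n p s → Vtx n p s → Prop where
  | core (i : Fin n) :
      TRel n p s (Sum.inl ()) (Sum.inr (Sum.inl i))
  | pathRoot (i : Fin n) (j : Fin (p i)) :
      TRel n p s (Sum.inr (Sum.inl i)) (Sum.inr (Sum.inr (Sum.inl ⟨i, j, 0⟩)))
  | pathEdge (i : Fin n) (j : Fin (p i)) (l : Fin 2) :
      TRel n p s (Sum.inr (Sum.inr (Sum.inl ⟨i, j, l.castSucc⟩)))
        (Sum.inr (Sum.inr (Sum.inl ⟨i, j, l.succ⟩)))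
  | starRoot (i : Fin n) (j : Fin (s i)) :
      TRel n p s (Sum.inr (Sum.inl i)) (Sum.inr (Sum.inr (Sum.inr ⟨i, j, 0⟩)))
  | starEdge (i : Fin n) (j : Fin (s i)) (l : Fin 2) :
      TRel n p s (Sum.inr (Sum.inr (Sum.inr ⟨i, j, 0⟩)))
        (Sum.inr (Sum.inr (Sum.inr ⟨i, j, l.succ⟩)))

/-- The tree `T(p,s)`. -/
def TpsGraph (n : ℕ) (p s : Fin n → ℕ) : SimpleGraph (Vtx n p s) :=
  SimpleGraph.fromRel (TRel n p s)

/-- The PTE-tree `T_α(p) = T(p, α - p)`. -/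
def Ttree (α : ℕ) {n : ℕ} (p : Fin n → ℕ) : SimpleGraph (Vtx n p (fun i => α - p i)) :=
  TpsGraph n p (fun i => α - p i)

/-- `p` is an `α`-compatible sequence: it has length `n ≥ 2` and all entries `≤ α`. -/
def AlphaCompatible (α : ℕ) {n : ℕ} (p : Fin n → ℕ) : Prop :=
  2 ≤ n ∧ ∀ i, p i ≤ α

/-- A graph is a PTE-tree if it is isomorphic to some `T_α(p)` with `α` a positive
integer and `p` an `α`-compatible sequence. -/
def IsPTETree {V : Type} [Fintype V] (G : SimpleGraph V) : Prop :=
  ∃ (n α : ℕ) (p : Fin n → ℕ), 0 < α ∧ AlphaCompatible α p ∧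
    Nonempty (G ≃g Ttree α p)

/-- If `f` retracts a graph onto a system of representatives of its connected components, then
the component sizes are the fibre sizes of `f`. -/
theorem componentSizes_eq_map_fiber {V : Type} [Fintype V] [DecidableEq V]
    (H : SimpleGraph V) (f : V → V)
    (hadj : ∀ u v, H.Adj u v → f u = f v) (hreach : ∀ v, H.Reachable v (f v)) :
    componentSizes H = (Finset.univ.filter fun r => f r = r).val.map
      fun r => (Finset.univ.filter fun v => f v = r).card := by
  have hconst : ∀ u v, H.Reachable u v → f u = f v := by
    rintro u v ⟨q⟩
    induction q with
    | nil => rfl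
    | cons h _ ih => exact (hadj _ _ h).trans ih
  have hinj : Set.InjOn H.connectedComponentMk
      (↑(Finset.univ.filter fun r => f r = r) : Set V) := by
    intro u hu v hv h
    simp only [Finset.coe_filter, Finset.mem_univ, true_and, Set.mem_ofPred_eq] at hu hv
    rw [← hu, ← hv]
    exact hconst _ _ (SimpleGraph.ConnectedComponent.exact h)
  have himg : ∀ _ : Fintype H.ConnectedComponent, (Finset.univ : Finset H.ConnectedComponent)
      = (Finset.univ.filter fun r => f r = r).image H.connectedComponentMk := by
    intro _
    ext c
    induction c using SimpleGraph.ConnectedComponent.ind with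
    | h v =>
      simp only [Finset.mem_univ, Finset.mem_image, Finset.mem_filter, true_and, true_iff]
      exact ⟨f v, (hconst _ _ (hreach v)).symm,
        SimpleGraph.ConnectedComponent.sound (hreach v).symm⟩
  unfold componentSizes
  rw [himg, Finset.image_val_of_injOn hinj, Multiset.map_map]
  refine Multiset.map_congr rfl fun r hr => ?_
  have hr' : f r = r := by simpa using hr
  simp only [Function.comp_apply]
  rw [Nat.card_eq_fintype_card, Fintype.card_subtype]
  congr 1
  ext v
  simp only [Finset.mem_filter, Finset.mem_univ, true_and,
    SimpleGraph.ConnectedComponent.mem_supp_iff]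
  constructor
  · intro h
    rw [hconst _ _ (SimpleGraph.ConnectedComponent.exact h), hr']
  · rintro rfl
    exact SimpleGraph.ConnectedComponent.sound (hreach v)

theorem componentSizes_congr {V V' : Type} [Fintype V] [Fintype V'] {H : SimpleGraph V}
    {H' : SimpleGraph V'} (e : H ≃g H') : componentSizes H = componentSizes H' := by
  unfold componentSizes
  rw [← Finset.map_univ_equiv e.connectedComponentEquiv, Finset.map_val, Multiset.map_map]
  refine Multiset.map_congr rfl fun c _ => ?_
  exact Nat.card_congr (SimpleGraph.ConnectedComponent.isoEquivSupp e c)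

theorem UPoly_eq_map {V : Type} [Fintype V] (G : SimpleGraph V) :
    UPoly G = G.edgeFinset.powerset.val.map
      fun A : Finset (Sym2 V) => componentSizes (G.deleteEdges (A : Set (Sym2 V))) := by
  unfold UPoly
  simp only [Multiset.bind_def, Multiset.pure_def, Multiset.bind_singleton, Multiset.map_map,
    Function.comp_def]

/-- Isomorphic graphs have the same `U`-polynomial. -/
theorem UPoly_congr {V V' : Type} [Fintype V] [Fintype V'] {G : SimpleGraph V}
    {G' : SimpleGraph V'} (e : G ≃g G') : UPoly G = UPoly G' := by
  have hmap : Function.Injective (Sym2.map e) := Sym2.map.injective e.injective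
  have hE : G'.edgeFinset = G.edgeFinset.image (Sym2.map e) := by
    ext x
    induction x with
    | h a b =>
      have hx : s(a, b) = Sym2.map e s(e.symm a, e.symm b) := by simp
      rw [hx, hmap.mem_finset_image, SimpleGraph.mem_edgeFinset, SimpleGraph.mem_edgeFinset,
        ← hx, SimpleGraph.mem_edgeSet, SimpleGraph.mem_edgeSet]
      exact (e.symm.map_adj_iff).symm
  have hinj : Function.Injective fun A : Finset (Sym2 V) => A.image (Sym2.map e) :=
    Finset.image_injective hmap
  rw [UPoly_eq_map, UPoly_eq_map, hE, Finset.powerset_image, Finset.image_val_of_injOn hinj.injOn,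
    Multiset.map_map]
  refine Multiset.map_congr rfl fun A _ => componentSizes_congr ⟨e.toEquiv, fun {a b} => ?_⟩
  have hmem : s(e a, e b) ∈ A.image (Sym2.map e) ↔ s(a, b) ∈ A :=
    hmap.mem_finset_image (a := s(a, b))
  simp only [SimpleGraph.deleteEdges_adj, Finset.mem_coe]
  exact and_congr e.map_adj_iff (not_congr hmem)

/-- Vertices of `T(p,s)` other than the centre. -/
abbrev OuterVtx (n : ℕ) (p s : Fin n → ℕ) : Type :=
  Fin n ⊕ ((Σ i : Fin n, Fin (p i) × Fin 3) ⊕ (Σ i : Fin n, Fin (s i) × Fin 3))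

/-- The neighbour of a non-central vertex on its way to the centre. -/
def parent {n : ℕ} {p s : Fin n → ℕ} : OuterVtx n p s → Vtx n p s
  | .inl _ => .inl ()
  | .inr (.inl ⟨i, _, 0⟩) => .inr (.inl i)
  | .inr (.inl ⟨i, j, 1⟩) => .inr (.inr (.inl ⟨i, j, 0⟩))
  | .inr (.inl ⟨i, j, 2⟩) => .inr (.inr (.inl ⟨i, j, 1⟩))
  | .inr (.inr ⟨i, _, 0⟩) => .inr (.inl i)
  | .inr (.inr ⟨i, j, 1⟩) => .inr (.inr (.inr ⟨i, j, 0⟩))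
  | .inr (.inr ⟨i, j, 2⟩) => .inr (.inr (.inr ⟨i, j, 0⟩))

theorem TRel_iff_parent {n : ℕ} {p s : Fin n → ℕ} {u v : Vtx n p s} :
    TRel n p s u v ↔ ∃ x : OuterVtx n p s, v = .inr x ∧ u = parent x := by
  constructor
  · rintro (i | ⟨i, j⟩ | ⟨i, j, l⟩ | ⟨i, j⟩ | ⟨i, j, l⟩)
    · exact ⟨.inl i, rfl, rfl⟩
    · exact ⟨.inr (.inl ⟨i, j, 0⟩), rfl, rfl⟩
    · fin_cases l
      · exact ⟨.inr (.inl ⟨i, j, 1⟩), rfl, rfl⟩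
      · exact ⟨.inr (.inl ⟨i, j, 2⟩), rfl, rfl⟩
    · exact ⟨.inr (.inr ⟨i, j, 0⟩), rfl, rfl⟩
    · fin_cases l
      · exact ⟨.inr (.inr ⟨i, j, 1⟩), rfl, rfl⟩
      · exact ⟨.inr (.inr ⟨i, j, 2⟩), rfl, rfl⟩
  · rintro ⟨i | ⟨i, j, l⟩ | ⟨i, j, l⟩, rfl, rfl⟩
    · exact .core i
    · fin_cases l
      · exact .pathRoot i j
      · exact .pathEdge i j 0
      · exact .pathEdge i j 1
    · fin_cases l
      · exact .starRoot i j
      · exact .starEdge i j 0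
      · exact .starEdge i j 1

/-- The distance to the centre. -/
def depth {n : ℕ} {p s : Fin n → ℕ} : Vtx n p s → ℕ
  | .inl _ => 0
  | .inr (.inl _) => 1
  | .inr (.inr (.inl ⟨_, _, l⟩)) => 2 + l
  | .inr (.inr (.inr ⟨_, _, l⟩)) => if l = 0 then 2 else 3

theorem depth_parent {n : ℕ} {p s : Fin n → ℕ} (x : OuterVtx n p s) :
    depth (parent x) + 1 = depth (.inr x) := by
  obtain i | ⟨i, j, l⟩ | ⟨i, j, l⟩ := x
  · rfl
  · fin_cases l <;> rfl
  · fin_cases l <;> rfl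

theorem TpsGraph_adj {n : ℕ} {p s : Fin n → ℕ} {u v : Vtx n p s} :
    (TpsGraph n p s).Adj u v ↔ TRel n p s u v ∨ TRel n p s v u := by
  unfold TpsGraph
  rw [SimpleGraph.fromRel_adj, and_iff_right_iff_imp]
  simp only [TRel_iff_parent]
  rintro (⟨x, rfl, rfl⟩ | ⟨x, rfl, rfl⟩) h
  · have := depth_parent x
    rw [h] at this
    omega
  · have := depth_parent x
    rw [← h] at this
    omega

/-- The edge joining a non-central vertex to its parent. -/
def parentEdge {n : ℕ} {p s : Fin n → ℕ} (x : OuterVtx n p s) : Sym2 (Vtx n p s) :=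
  s(parent x, .inr x)

theorem parentEdge_injective {n : ℕ} {p s : Fin n → ℕ} :
    Function.Injective (parentEdge (n := n) (p := p) (s := s)) := by
  intro x y h
  have hx := depth_parent x
  have hy := depth_parent y
  rcases Sym2.eq_iff.1 h with ⟨_, h⟩ | ⟨h₁, h₂⟩
  · exact Sum.inr_injective h
  · rw [h₁] at hx
    rw [← h₂] at hy
    omega

theorem edgeFinset_TpsGraph {n : ℕ} {p s : Fin n → ℕ} :
    (TpsGraph n p s).edgeFinset = Finset.univ.image parentEdge := by
  ext e
  induction e with
  | h u v =>
    simp only [SimpleGraph.mem_edgeFinset, SimpleGraph.mem_edgeSet, TpsGraph_adj,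
      TRel_iff_parent, Finset.mem_image, Finset.mem_univ, true_and, parentEdge, Sym2.eq_iff]
    constructor
    · rintro (⟨x, rfl, rfl⟩ | ⟨x, rfl, rfl⟩) <;> exact ⟨x, by simp⟩
    · rintro ⟨x, ⟨rfl, rfl⟩ | ⟨rfl, rfl⟩⟩
      · exact .inl ⟨x, rfl, rfl⟩
      · exact .inr ⟨x, rfl, rfl⟩

/-- The vertex map induced by a rearrangement of the branches. -/
def permVtx {n : ℕ} {p s p' s' : Fin n → ℕ} (σ : Equiv.Perm (Fin n))
    (hp : ∀ i, p i = p' (σ i)) (hs : ∀ i, s i = s' (σ i)) : Vtx n p s → Vtx n p' s'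
  | .inl _ => .inl ()
  | .inr (.inl i) => .inr (.inl (σ i))
  | .inr (.inr (.inl ⟨i, j, l⟩)) => .inr (.inr (.inl ⟨σ i, Fin.cast (hp i) j, l⟩))
  | .inr (.inr (.inr ⟨i, j, l⟩)) => .inr (.inr (.inr ⟨σ i, Fin.cast (hs i) j, l⟩))

theorem permVtx_TRel {n : ℕ} {p s p' s' : Fin n → ℕ} (σ : Equiv.Perm (Fin n))
    (hp : ∀ i, p i = p' (σ i)) (hs : ∀ i, s i = s' (σ i)) {u v : Vtx n p s}
    (h : TRel n p s u v) : TRel n p' s' (permVtx σ hp hs u) (permVtx σ hp hs v) := by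
  cases h with
  | core i => exact .core _
  | pathRoot i j => exact .pathRoot _ _
  | pathEdge i j l => exact .pathEdge _ _ l
  | starRoot i j => exact .starRoot _ _
  | starEdge i j l => exact .starEdge _ _ l

theorem permVtx_leftInverse {n : ℕ} {p s p' s' : Fin n → ℕ} (σ : Equiv.Perm (Fin n))
    (hp : ∀ i, p i = p' (σ i)) (hs : ∀ i, s i = s' (σ i))
    (hp' : ∀ i, p' i = p (σ.symm i)) (hs' : ∀ i, s' i = s (σ.symm i)) :
    Function.LeftInverse (permVtx σ.symm hp' hs') (permVtx σ hp hs) := by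
  have key : ∀ (q : Fin n → ℕ) (i i' : Fin n) (h : i' = i) (j : Fin (q i)) (j' : Fin (q i'))
      (l : Fin 3), (j' : ℕ) = j →
      (⟨i', j', l⟩ : Σ i : Fin n, Fin (q i) × Fin 3) = ⟨i, j, l⟩ := by
    rintro q i _ rfl j j' l h
    rw [Fin.ext h]
  rintro (_ | i | ⟨i, j, l⟩ | ⟨i, j, l⟩)
  · rfl
  · simp [permVtx]
  · exact congrArg (fun x => Sum.inr (Sum.inr (Sum.inl x)))
      (key p i _ (σ.symm_apply_apply i) j _ l rfl)
  · exact congrArg (fun x => Sum.inr (Sum.inr (Sum.inr x)))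
      (key s i _ (σ.symm_apply_apply i) j _ l rfl)

/-- Rearranging the branches does not change the isomorphism type of `T(p,s)`. -/
theorem nonempty_iso_of_perm {n : ℕ} {p s p' s' : Fin n → ℕ} (σ : Equiv.Perm (Fin n))
    (hp : ∀ i, p i = p' (σ i)) (hs : ∀ i, s i = s' (σ i)) :
    Nonempty (TpsGraph n p s ≃g TpsGraph n p' s') := by
  have hp' : ∀ i, p' i = p (σ.symm i) := fun i => by simp [hp]
  have hs' : ∀ i, s' i = s (σ.symm i) := fun i => by simp [hs]
  have hl := permVtx_leftInverse σ hp hs hp' hs'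
  refine ⟨⟨⟨permVtx σ hp hs, permVtx σ.symm hp' hs', hl,
    permVtx_leftInverse σ.symm hp' hs' hp hs⟩, fun {u v} => ?_⟩⟩
  simp only [Equiv.coe_fn_mk, TpsGraph_adj]
  constructor
  · rintro (h | h)
    · have := permVtx_TRel σ.symm hp' hs' h
      rw [hl, hl] at this
      exact .inl this
    · have := permVtx_TRel σ.symm hp' hs' h
      rw [hl, hl] at this
      exact .inr this
  · exact Or.imp (permVtx_TRel σ hp hs) (permVtx_TRel σ hp hs)

/-- The top vertex of the component of a vertex once the parent edges of the vertices marked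
by `cut` are removed. -/
def top {n : ℕ} {p s : Fin n → ℕ} (cut : OuterVtx n p s → Bool) : Vtx n p s → Vtx n p s
  | .inl _ => .inl ()
  | .inr x => if cut x then .inr x else top cut (parent x)
termination_by v => depth v
decreasing_by
  rw [← depth_parent]
  exact Nat.lt_succ_self _

theorem top_inl {n : ℕ} {p s : Fin n → ℕ} (cut : OuterVtx n p s → Bool) (u : Unit) :
    top cut (.inl u) = .inl () := by
  rw [top]

theorem top_inr {n : ℕ} {p s : Fin n → ℕ} (cut : OuterVtx n p s → Bool)
    (x : OuterVtx n p s) :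
    top cut (.inr x) = if cut x then .inr x else top cut (parent x) := by
  rw [top]

theorem vtx_induction {n : ℕ} {p s : Fin n → ℕ} {motive : Vtx n p s → Prop}
    (centre : motive (.inl ())) (outer : ∀ x, motive (parent x) → motive (.inr x))
    (v : Vtx n p s) : motive v := by
  induction h : depth v generalizing v with
  | zero =>
    obtain _ | x := v
    · exact centre
    · have := depth_parent x
      omega
  | succ d ih =>
    obtain _ | x := v
    · exact centre
    · have := depth_parent x
      exact outer x (ih _ (by omega))

theorem depth_top_le {n : ℕ} {p s : Fin n → ℕ} (cut : OuterVtx n p s → Bool)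
    (v : Vtx n p s) : depth (top cut v) ≤ depth v := by
  induction v using vtx_induction with
  | centre => rw [top_inl]
  | outer x ih =>
    have := depth_parent x
    rw [top_inr]
    split_ifs <;> omega

theorem top_inr_eq_self_iff {n : ℕ} {p s : Fin n → ℕ} (cut : OuterVtx n p s → Bool)
    (x : OuterVtx n p s) : top cut (.inr x) = .inr x ↔ cut x = true := by
  rw [top_inr]
  split_ifs with h
  · simp [h]
  · refine iff_of_false (fun h' => ?_) h
    have h₁ := depth_top_le cut (parent x)
    have h₂ := depth_parent x
    rw [h'] at h₁
    omega

/-- The set of parent edges of the vertices marked by `cut`. -/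
noncomputable def cutEdges {n : ℕ} {p s : Fin n → ℕ} (cut : OuterVtx n p s → Bool) :
    Finset (Sym2 (Vtx n p s)) :=
  (Finset.univ.filter fun x => cut x = true).image parentEdge

theorem parentEdge_mem_cutEdges {n : ℕ} {p s : Fin n → ℕ} (cut : OuterVtx n p s → Bool)
    (x : OuterVtx n p s) : parentEdge x ∈ cutEdges cut ↔ cut x = true := by
  unfold cutEdges
  rw [parentEdge_injective.mem_finset_image]
  simp

theorem componentSizes_cutEdges {n : ℕ} {p s : Fin n → ℕ} (cut : OuterVtx n p s → Bool) :
    componentSizes ((TpsGraph n p s).deleteEdges (cutEdges cut : Set (Sym2 (Vtx n p s)))) =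
      (Finset.univ.filter fun v => top cut v = .inl ()).card ::ₘ
        (Finset.univ.filter fun x => cut x = true).val.map fun x =>
          (Finset.univ.filter fun v => top cut v = .inr x).card := by
  have hstep : ∀ x, cut x ≠ true → top cut (.inr x) = top cut (parent x) := by
    intro x hx
    rw [top_inr, if_neg hx]
  have hadj : ∀ x, cut x ≠ true → ((TpsGraph n p s).deleteEdges
      (cutEdges cut : Set (Sym2 (Vtx n p s)))).Adj (parent x) (.inr x) := by
    intro x hx
    rw [SimpleGraph.deleteEdges_adj, Finset.mem_coe]
    exact ⟨TpsGraph_adj.2 (.inl (TRel_iff_parent.2 ⟨x, rfl, rfl⟩)),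
      fun h => hx ((parentEdge_mem_cutEdges cut x).1 h)⟩
  rw [componentSizes_eq_map_fiber _ (top cut)]
  · have hfix : (Finset.univ.filter fun v => top cut v = v) =
        Finset.cons (.inl ()) ((Finset.univ.filter fun x => cut x = true).map
          Function.Embedding.inr) (by simp) := by
      ext v
      obtain _ | x := v
      · simp [top_inl]
      · simp [top_inr_eq_self_iff]
    rw [hfix, Finset.cons_val, Multiset.map_cons, Finset.map_val, Multiset.map_map]
    rfl
  · intro u v h
    rw [SimpleGraph.deleteEdges_adj, TpsGraph_adj, Finset.mem_coe] at h
    obtain ⟨h | h, hcut⟩ := h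
    · obtain ⟨x, rfl, rfl⟩ := TRel_iff_parent.1 h
      exact (hstep x fun hx => hcut ((parentEdge_mem_cutEdges cut x).2 hx)).symm
    · obtain ⟨x, rfl, rfl⟩ := TRel_iff_parent.1 h
      rw [Sym2.eq_swap] at hcut
      exact hstep x fun hx => hcut ((parentEdge_mem_cutEdges cut x).2 hx)
  · intro v
    induction v using vtx_induction with
    | centre => rw [top_inl]
    | outer x ih =>
      by_cases hx : cut x = true
      · rw [top_inr, if_pos hx]
      · rw [hstep x hx]
        exact (hadj x hx).symm.reachable.trans ih

/-- If `sz` satisfies the recursion for the number of descendants of a vertex reachable without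
using cut edges, then it computes the component sizes. -/
theorem card_top_fiber {n : ℕ} {p s : Fin n → ℕ} (cut : OuterVtx n p s → Bool)
    (sz : Vtx n p s → ℕ)
    (hsz : ∀ v, sz v = 1 + ∑ x with parent x = v, if cut x then 0 else sz (.inr x))
    (r : Vtx n p s) (hr : top cut r = r) :
    (Finset.univ.filter fun v => top cut v = r).card = sz r := by
  have hmem : r ∈ Finset.univ.filter fun v => top cut v = r := by simp [hr]
  have hsum : ∑ v with top cut v = r, sz v =
      (Finset.univ.filter fun v => top cut v = r).card +
        ∑ v ∈ (Finset.univ.filter fun v => top cut v = r).erase r, sz v := by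
    rw [Finset.sum_congr rfl fun v _ => hsz v, Finset.sum_add_distrib, Finset.sum_const,
      smul_eq_mul, mul_one]
    congr 1
    have hL : ∑ v with top cut v = r, ∑ x with parent x = v,
        (if cut x then 0 else sz (.inr x)) =
        ∑ x, if top cut (parent x) = r then (if cut x then 0 else sz (.inr x)) else 0 := by
      rw [← Finset.sum_filter]
      refine (Finset.sum_congr rfl fun v hv => ?_).trans (Finset.sum_fiberwise_of_maps_to
        (s := Finset.univ.filter fun x => top cut (parent x) = r) (g := parent)
        (fun x hx => by simpa using hx) _)
      refine Finset.sum_congr ?_ fun _ _ => rfl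
      ext x
      simp only [Finset.mem_filter, Finset.mem_univ, true_and] at hv ⊢
      constructor
      · rintro rfl
        exact ⟨hv, rfl⟩
      · exact And.right
    rw [hL, ← Finset.filter_ne', Finset.filter_filter, Finset.sum_filter]
    refine Eq.trans ?_ (Fintype.sum_sum_type _).symm
    refine Eq.trans ?_ (congrArg (· + _) (Finset.sum_eq_zero fun u _ => if_neg ?_)).symm
    swap
    · rw [top_inl]
      exact fun h => h.2 h.1
    rw [zero_add]
    refine Finset.sum_congr rfl fun x _ => ?_
    by_cases hx : cut x = true
    · simp [top_inr, hx]
    · have hne : (.inr x : Vtx n p s) ≠ r := by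
        rintro rfl
        exact hx ((top_inr_eq_self_iff cut x).1 hr)
      simp [top_inr, hx, hne]
  rw [← Finset.add_sum_erase _ _ hmem] at hsum
  omega

theorem sum_children_centre {n : ℕ} {p s : Fin n → ℕ} (g : OuterVtx n p s → ℕ) :
    ∑ x with parent x = .inl (), g x = ∑ i, g (.inl i) := by
  rw [Finset.sum_filter]
  simp only [Fintype.sum_sum_type, Fintype.sum_sigma, Fintype.sum_prod_type, Fin.sum_univ_three]
  simp [parent]

theorem sum_children_root {n : ℕ} {p s : Fin n → ℕ} (g : OuterVtx n p s → ℕ) (i : Fin n) :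
    ∑ x with parent x = .inr (.inl i), g x =
      ∑ j, g (.inr (.inl ⟨i, j, 0⟩)) + ∑ j, g (.inr (.inr ⟨i, j, 0⟩)) := by
  rw [Finset.sum_filter]
  simp only [Fintype.sum_sum_type, Fintype.sum_sigma, Fintype.sum_prod_type, Fin.sum_univ_three]
  simp [parent]

theorem children_path_zero {n : ℕ} {p s : Fin n → ℕ} (i : Fin n) (j : Fin (p i)) :
    (Finset.univ.filter fun x : OuterVtx n p s => parent x = .inr (.inr (.inl ⟨i, j, 0⟩))) =
      {.inr (.inl ⟨i, j, 1⟩)} := by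
  ext x
  rw [Finset.mem_filter, Finset.mem_singleton]
  constructor
  · obtain i' | ⟨i', j', l⟩ | ⟨i', j', l⟩ := x
    · rintro ⟨-, ⟨⟩⟩
    · fin_cases l <;> rintro ⟨-, ⟨⟩⟩
      rfl
    · fin_cases l <;> rintro ⟨-, ⟨⟩⟩
  · rintro rfl
    exact ⟨Finset.mem_univ _, rfl⟩

theorem children_path_one {n : ℕ} {p s : Fin n → ℕ} (i : Fin n) (j : Fin (p i)) :
    (Finset.univ.filter fun x : OuterVtx n p s => parent x = .inr (.inr (.inl ⟨i, j, 1⟩))) =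
      {.inr (.inl ⟨i, j, 2⟩)} := by
  ext x
  rw [Finset.mem_filter, Finset.mem_singleton]
  constructor
  · obtain i' | ⟨i', j', l⟩ | ⟨i', j', l⟩ := x
    · rintro ⟨-, ⟨⟩⟩
    · fin_cases l <;> rintro ⟨-, ⟨⟩⟩
      rfl
    · fin_cases l <;> rintro ⟨-, ⟨⟩⟩
  · rintro rfl
    exact ⟨Finset.mem_univ _, rfl⟩

theorem children_star_zero {n : ℕ} {p s : Fin n → ℕ} (i : Fin n) (j : Fin (s i)) :
    (Finset.univ.filter fun x : OuterVtx n p s => parent x = .inr (.inr (.inr ⟨i, j, 0⟩))) =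
      {.inr (.inr ⟨i, j, 1⟩), .inr (.inr ⟨i, j, 2⟩)} := by
  ext x
  rw [Finset.mem_filter, Finset.mem_insert, Finset.mem_singleton]
  constructor
  · obtain i' | ⟨i', j', l⟩ | ⟨i', j', l⟩ := x
    · rintro ⟨-, ⟨⟩⟩
    · fin_cases l <;> rintro ⟨-, ⟨⟩⟩
    · fin_cases l <;> rintro ⟨-, ⟨⟩⟩
      · exact .inl rfl
      · exact .inr rfl
  · rintro (rfl | rfl) <;> exact ⟨Finset.mem_univ _, rfl⟩

theorem parent_ne_path_two {n : ℕ} {p s : Fin n → ℕ} (i : Fin n) (j : Fin (p i))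
    (x : OuterVtx n p s) : parent x ≠ .inr (.inr (.inl ⟨i, j, 2⟩)) := by
  obtain i' | ⟨i', j', l⟩ | ⟨i', j', l⟩ := x
  · rintro ⟨⟩
  · fin_cases l <;> rintro ⟨⟩
  · fin_cases l <;> rintro ⟨⟩

theorem parent_ne_star_leaf {n : ℕ} {p s : Fin n → ℕ} (i : Fin n) (j : Fin (s i)) (l : Fin 3)
    (hl : l ≠ 0) (x : OuterVtx n p s) : parent x ≠ .inr (.inr (.inr ⟨i, j, l⟩)) := by
  obtain i' | ⟨i', j', l'⟩ | ⟨i', j', l'⟩ := x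
  · rintro ⟨⟩
  · fin_cases l' <;> rintro ⟨⟩
  · fin_cases l' <;> rintro ⟨⟩ <;> exact hl rfl

/-- The number of vertices of a hanging path that stay connected to the root when the edges above
the vertices marked by `a` are removed. -/
def pathHang (a : Fin 3 → Bool) : ℕ :=
  if a 0 then 0 else 1 + if a 1 then 0 else 1 + if a 2 then 0 else 1

/-- The number of vertices of a hanging star that stay connected to the root when the edges above
the vertices marked by `a` are removed. -/
def starHang (a : Fin 3 → Bool) : ℕ :=
  if a 0 then 0 else 1 + ((if a 1 then 0 else 1) + if a 2 then 0 else 1)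

/-- The number of vertices of a branch, other than its root, that stay connected to the root. -/
def branchHang {P S : ℕ} (a : Fin P → Fin 3 → Bool) (b : Fin S → Fin 3 → Bool) : ℕ :=
  ∑ j, pathHang (a j) + ∑ j, starHang (b j)

/-- A choice of non-central vertices, organised by branches. -/
abbrev Cfg (n : ℕ) (p s : Fin n → ℕ) : Type :=
  ∀ i : Fin n, Bool × (Fin (p i) → Fin 3 → Bool) × (Fin (s i) → Fin 3 → Bool)

/-- The characteristic function of a configuration. -/
def cfgCut {n : ℕ} {p s : Fin n → ℕ} (c : Cfg n p s) : OuterVtx n p s → Bool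
  | .inl i => (c i).1
  | .inr (.inl ⟨i, j, l⟩) => (c i).2.1 j l
  | .inr (.inr ⟨i, j, l⟩) => (c i).2.2 j l

/-- The number of vertices of a component below a given vertex. -/
def cfgSize {n : ℕ} {p s : Fin n → ℕ} (c : Cfg n p s) : Vtx n p s → ℕ
  | .inl _ => 1 + ∑ i, if (c i).1 then 0 else 1 + branchHang (c i).2.1 (c i).2.2
  | .inr (.inl i) => 1 + branchHang (c i).2.1 (c i).2.2
  | .inr (.inr (.inl ⟨i, j, 0⟩)) =>
      1 + if (c i).2.1 j 1 then 0 else 1 + if (c i).2.1 j 2 then 0 else 1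
  | .inr (.inr (.inl ⟨i, j, 1⟩)) => 1 + if (c i).2.1 j 2 then 0 else 1
  | .inr (.inr (.inl ⟨_, _, 2⟩)) => 1
  | .inr (.inr (.inr ⟨i, j, 0⟩)) =>
      1 + ((if (c i).2.2 j 1 then 0 else 1) + if (c i).2.2 j 2 then 0 else 1)
  | .inr (.inr (.inr ⟨_, _, 1⟩)) => 1
  | .inr (.inr (.inr ⟨_, _, 2⟩)) => 1

theorem cfgSize_eq {n : ℕ} {p s : Fin n → ℕ} (c : Cfg n p s) (v : Vtx n p s) :
    cfgSize c v =
      1 + ∑ x with parent x = v, if cfgCut c x then 0 else cfgSize c (.inr x) := by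
  obtain _ | i | ⟨i, j, l⟩ | ⟨i, j, l⟩ := v
  · rw [sum_children_centre]
    rfl
  · rw [sum_children_root]
    rfl
  · fin_cases l
    · change cfgSize c (.inr (.inr (.inl ⟨i, j, 0⟩))) =
        1 + ∑ x with parent x = .inr (.inr (.inl ⟨i, j, 0⟩)), _
      rw [children_path_zero, Finset.sum_singleton]
      rfl
    · change cfgSize c (.inr (.inr (.inl ⟨i, j, 1⟩))) =
        1 + ∑ x with parent x = .inr (.inr (.inl ⟨i, j, 1⟩)), _
      rw [children_path_one, Finset.sum_singleton]
      rfl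
    · change cfgSize c (.inr (.inr (.inl ⟨i, j, 2⟩))) =
        1 + ∑ x with parent x = .inr (.inr (.inl ⟨i, j, 2⟩)), _
      rw [Finset.filter_false_of_mem fun x _ => parent_ne_path_two i j x]
      rfl
  · fin_cases l
    · change cfgSize c (.inr (.inr (.inr ⟨i, j, 0⟩))) =
        1 + ∑ x with parent x = .inr (.inr (.inr ⟨i, j, 0⟩)), _
      rw [children_star_zero, Finset.sum_pair (by rintro ⟨⟩)]
      rfl
    · change cfgSize c (.inr (.inr (.inr ⟨i, j, 1⟩))) =
        1 + ∑ x with parent x = .inr (.inr (.inr ⟨i, j, 1⟩)), _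
      rw [Finset.filter_false_of_mem fun x _ => parent_ne_star_leaf i j 1 (by decide) x]
      rfl
    · change cfgSize c (.inr (.inr (.inr ⟨i, j, 2⟩))) =
        1 + ∑ x with parent x = .inr (.inr (.inr ⟨i, j, 2⟩)), _
      rw [Finset.filter_false_of_mem fun x _ => parent_ne_star_leaf i j 2 (by decide) x]
      rfl

open Polynomial

/-- The contribution of the components inside a hanging path. -/
def pathWeight (w : ℕ → ℚ) (a : Fin 3 → Bool) : ℚ :=
  (if a 0 then w (1 + if a 1 then 0 else 1 + if a 2 then 0 else 1) else 1) *
    (if a 1 then w (1 + if a 2 then 0 else 1) else 1) * (if a 2 then w 1 else 1)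

/-- The contribution of the components inside a hanging star. -/
def starWeight (w : ℕ → ℚ) (a : Fin 3 → Bool) : ℚ :=
  (if a 0 then w (1 + ((if a 1 then 0 else 1) + if a 2 then 0 else 1)) else 1) *
    (if a 1 then w 1 else 1) * (if a 2 then w 1 else 1)

/-- The contribution of the components inside a branch that avoid its root. -/
def branchWeight (w : ℕ → ℚ) {P S : ℕ} (a : Fin P → Fin 3 → Bool) (b : Fin S → Fin 3 → Bool) :
    ℚ :=
  (∏ j, pathWeight w (a j)) * ∏ j, starWeight w (b j)

/-- The rooted generating function of a hanging path. -/
noncomputable def pathPoly (w : ℕ → ℚ) : ℚ[X] :=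
  ∑ a : Fin 3 → Bool, C (pathWeight w a) * X ^ pathHang a

/-- The rooted generating function of a hanging star. -/
noncomputable def starPoly (w : ℕ → ℚ) : ℚ[X] :=
  ∑ a : Fin 3 → Bool, C (starWeight w a) * X ^ starHang a

/-- The rooted generating function of a branch `B(P, S)`. -/
noncomputable def branchPoly (w : ℕ → ℚ) (P S : ℕ) : ℚ[X] :=
  X * pathPoly w ^ P * starPoly w ^ S

/-- The linear functional sending `X ^ m` to `w m`. -/
noncomputable def umbral (w : ℕ → ℚ) : ℚ[X] →ₗ[ℚ] ℚ :=
  Polynomial.lsum fun m => w m • LinearMap.id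

theorem umbral_C_mul_X_pow (w : ℕ → ℚ) (a : ℚ) (m : ℕ) :
    umbral w (C a * X ^ m) = a * w m := by
  rw [umbral, Polynomial.lsum_apply, C_mul_X_pow_eq_monomial,
    sum_monomial_index _ _ (by simp)]
  simp [mul_comm]

theorem branchPoly_eq_sum (w : ℕ → ℚ) (P S : ℕ) :
    branchPoly w P S = ∑ ab : (Fin P → Fin 3 → Bool) × (Fin S → Fin 3 → Bool),
      C (branchWeight w ab.1 ab.2) * X ^ (1 + branchHang ab.1 ab.2) := by
  have hpow : ∀ (m : ℕ) (f : (Fin 3 → Bool) → ℚ) (g : (Fin 3 → Bool) → ℕ),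
      (∑ a, C (f a) * X ^ g a) ^ m =
        ∑ a : Fin m → Fin 3 → Bool, C (∏ j, f (a j)) * (X : ℚ[X]) ^ ∑ j, g (a j) := by
    intro m f g
    rw [← Fin.prod_const, Finset.prod_univ_sum, Fintype.piFinset_univ]
    refine Finset.sum_congr rfl fun a _ => ?_
    rw [Finset.prod_mul_distrib, map_prod, Finset.prod_pow_eq_pow_sum]
  rw [branchPoly, pathPoly, starPoly, hpow, hpow, mul_assoc, Finset.sum_mul_sum,
    Fintype.sum_prod_type, Finset.mul_sum]
  refine Finset.sum_congr rfl fun a _ => ?_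
  rw [Finset.mul_sum]
  refine Finset.sum_congr rfl fun b _ => ?_
  simp only [branchWeight, branchHang, C_mul, pow_add, pow_one]
  ring

/-- The product of the weights of the components that avoid the centre. -/
theorem prod_weight_cfgSize (w : ℕ → ℚ) {n : ℕ} {p s : Fin n → ℕ} (c : Cfg n p s) :
    ∏ x with cfgCut c x = true, w (cfgSize c (.inr x)) =
      ∏ i, (if (c i).1 then w (1 + branchHang (c i).2.1 (c i).2.2) else 1) *
        branchWeight w (c i).2.1 (c i).2.2 := by
  rw [Finset.prod_filter]
  simp only [Fintype.prod_sum_type, Fintype.prod_sigma, Fintype.prod_prod_type,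
    Fin.prod_univ_three, branchWeight, Finset.prod_mul_distrib]
  simp only [← Finset.prod_mul_distrib]
  rfl

/-- The generating function of edge subsets by the size of the component of the centre, with the
other components weighted by `w`, factors over the branches. -/
theorem sum_cfg_eq_prod (w : ℕ → ℚ) {n : ℕ} (p s : Fin n → ℕ) :
    ∑ c : Cfg n p s, C (∏ x with cfgCut c x = true, w (cfgSize c (.inr x))) *
        X ^ cfgSize c (.inl ()) =
      X * ∏ i, (branchPoly w (p i) (s i) + C (umbral w (branchPoly w (p i) (s i)))) := by
  have hbranch : ∀ P S : ℕ, branchPoly w P S + C (umbral w (branchPoly w P S)) =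
      ∑ d : Bool × (Fin P → Fin 3 → Bool) × (Fin S → Fin 3 → Bool),
        C ((if d.1 then w (1 + branchHang d.2.1 d.2.2) else 1) * branchWeight w d.2.1 d.2.2) *
          X ^ (if d.1 then 0 else 1 + branchHang d.2.1 d.2.2) := by
    intro P S
    refine Eq.trans ?_ (Fintype.sum_prod_type _).symm
    rw [branchPoly_eq_sum, map_sum, map_sum, Fintype.sum_bool, add_comm]
    congr 1
    · refine Finset.sum_congr rfl fun ab _ => ?_
      rw [umbral_C_mul_X_pow]
      simp [mul_comm]
    · refine Finset.sum_congr rfl fun ab _ => ?_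
      simp
  simp_rw [hbranch]
  rw [Finset.prod_univ_sum, Fintype.piFinset_univ, Finset.mul_sum]
  refine Finset.sum_congr rfl fun c _ => ?_
  refine Eq.trans ?_ (congrArg (X * ·) Finset.prod_mul_distrib).symm
  rw [prod_weight_cfgSize, Finset.prod_pow_eq_pow_sum, map_prod]
  simp only [cfgSize, pow_add, pow_one]
  ring

/-- Configurations correspond to sets of non-central vertices. -/
theorem cfgCut_bijective {n : ℕ} {p s : Fin n → ℕ} :
    Function.Bijective (cfgCut : Cfg n p s → OuterVtx n p s → Bool) := by
  refine Function.bijective_iff_has_inverse.2 ⟨fun f i => (f (.inl i),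
    fun j l => f (.inr (.inl ⟨i, j, l⟩)), fun j l => f (.inr (.inr ⟨i, j, l⟩))),
    fun c => rfl, fun f => ?_⟩
  funext x
  obtain i | ⟨i, j, l⟩ | ⟨i, j, l⟩ := x <;> rfl

theorem UPoly_TpsGraph {n : ℕ} (p s : Fin n → ℕ) :
    UPoly (TpsGraph n p s) = (Finset.univ : Finset (Cfg n p s)).val.map fun c =>
      cfgSize c (.inl ()) ::ₘ (Finset.univ.filter fun x => cfgCut c x = true).val.map fun x =>
        cfgSize c (.inr x) := by
  have hsets : (TpsGraph n p s).edgeFinset.powerset =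
      (Finset.univ : Finset (Cfg n p s)).image fun c => cutEdges (cfgCut c) := by
    ext A
    rw [edgeFinset_TpsGraph, Finset.mem_powerset, Finset.mem_image]
    constructor
    · intro hA
      obtain ⟨c, hc⟩ := cfgCut_bijective.2 fun x : OuterVtx n p s => decide (parentEdge x ∈ A)
      refine ⟨c, Finset.mem_univ _, ?_⟩
      ext e
      rw [hc, cutEdges, Finset.mem_image]
      constructor
      · rintro ⟨x, hx, rfl⟩
        simpa using hx
      · intro he
        obtain ⟨x, -, rfl⟩ := Finset.mem_image.1 (hA he)
        exact ⟨x, by simpa using he, rfl⟩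
    · rintro ⟨c, -, rfl⟩
      exact Finset.image_subset_image (Finset.filter_subset _ _)
  have hinj : Function.Injective fun c : Cfg n p s => cutEdges (cfgCut c) := by
    intro c c' h
    refine cfgCut_bijective.1 (funext fun x => ?_)
    have := parentEdge_mem_cutEdges (cfgCut c) x
    rw [show cutEdges (cfgCut c) = cutEdges (cfgCut c') from h, parentEdge_mem_cutEdges] at this
    exact (Bool.eq_iff_iff.2 this).symm
  rw [UPoly_eq_map, hsets, Finset.image_val_of_injOn hinj.injOn, Multiset.map_map]
  refine Multiset.map_congr rfl fun c _ => ?_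
  rw [Function.comp_apply, componentSizes_cutEdges,
    card_top_fiber _ (cfgSize c) (cfgSize_eq c) _ (top_inl _ _)]
  congr 1
  refine Multiset.map_congr rfl fun x hx => ?_
  exact card_top_fiber _ (cfgSize c) (cfgSize_eq c) _
    ((top_inr_eq_self_iff _ x).2 (by simpa using hx))

/-- The product of the weights of the parts of a partition other than one part `M`,
or zero if there is no such part. -/
noncomputable def markedWeight (w : ℕ → ℚ) (M : ℕ) (l : Multiset ℕ) : ℚ :=
  if M ∈ l then ((l.erase M).map w).prod else 0

theorem pathHang_le (a : Fin 3 → Bool) : pathHang a ≤ 3 := by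
  unfold pathHang
  split_ifs <;> omega

theorem starHang_le (a : Fin 3 → Bool) : starHang a ≤ 3 := by
  unfold starHang
  split_ifs <;> omega

theorem branchHang_le {P S : ℕ} (a : Fin P → Fin 3 → Bool) (b : Fin S → Fin 3 → Bool) :
    branchHang a b ≤ 3 * (P + S) := by
  have ha := Finset.sum_le_card_nsmul Finset.univ (fun j => pathHang (a j)) 3
    fun j _ => pathHang_le _
  have hb := Finset.sum_le_card_nsmul Finset.univ (fun j => starHang (b j)) 3
    fun j _ => starHang_le _
  simp only [Finset.card_univ, Fintype.card_fin, smul_eq_mul] at ha hb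
  unfold branchHang
  omega

theorem cfgSize_inr_le {n : ℕ} {p s : Fin n → ℕ} {α : ℕ} (hα : 0 < α)
    (hps : ∀ i, p i + s i = α) (c : Cfg n p s) (x : OuterVtx n p s) :
    cfgSize c (.inr x) ≤ 3 * α + 1 := by
  obtain i | ⟨i, j, l⟩ | ⟨i, j, l⟩ := x
  · have := branchHang_le (c i).2.1 (c i).2.2
    rw [hps] at this
    simp only [cfgSize]
    omega
  · fin_cases l <;> simp only [cfgSize] <;> (try split_ifs) <;> omega
  · fin_cases l <;> simp only [cfgSize] <;> (try split_ifs) <;> omega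

/-- Summing the marked weights over the `U`-polynomial extracts a coefficient of the rooted
generating function of the tree. -/
theorem sum_markedWeight_UPoly (w : ℕ → ℚ) {n : ℕ} {p s : Fin n → ℕ} {α M : ℕ} (hα : 0 < α)
    (hps : ∀ i, p i + s i = α) (hM : 3 * α + 1 < M) :
    ((UPoly (TpsGraph n p s)).map (markedWeight w M)).sum =
      (X * ∏ i, (branchPoly w (p i) (s i) +
        C (umbral w (branchPoly w (p i) (s i))))).coeff M := by
  rw [← sum_cfg_eq_prod, finsetSum_coeff, UPoly_TpsGraph, Multiset.map_map]
  refine Finset.sum_congr rfl fun c _ => ?_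
  have hnot : M ∉ (Finset.univ.filter fun x => cfgCut c x = true).val.map
      fun x => cfgSize c (.inr x) := by
    intro h
    obtain ⟨x, -, hx⟩ := Multiset.mem_map.1 h
    have := cfgSize_inr_le hα hps c x
    omega
  rw [Function.comp_apply, markedWeight, coeff_C_mul, coeff_X_pow]
  by_cases h : M = cfgSize c (.inl ())
  · rw [if_pos h, if_pos (h ▸ Multiset.mem_cons_self _ _), h, Multiset.erase_cons_head,
      Multiset.map_map, mul_one]
    rfl
  · rw [if_neg h, if_neg, mul_zero]
    rw [Multiset.mem_cons]
    exact not_or.2 ⟨h, hnot⟩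

theorem sum_fin_three_bool {M : Type*} [AddCommMonoid M] (f : (Fin 3 → Bool) → M) :
    ∑ a, f a = ∑ x : Bool × Bool × Bool, f ![x.1, x.2.1, x.2.2] := by
  refine (Fintype.sum_bijective (fun x : Bool × Bool × Bool => ![x.1, x.2.1, x.2.2]) ?_ _ _
    fun _ => rfl).symm
  decide

theorem pathPoly_eq (w : ℕ → ℚ) :
    pathPoly w = X ^ 3 + C (w 1) * X ^ 2 + C (w 2 + w 1 ^ 2) * X +
      C (w 3 + 2 * w 1 * w 2 + w 1 ^ 3) := by
  rw [pathPoly, sum_fin_three_bool]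
  simp only [Fintype.sum_prod_type, Fintype.sum_bool]
  simp [pathWeight, pathHang, map_ofNat C 2]
  ring

theorem starPoly_eq (w : ℕ → ℚ) :
    starPoly w = X ^ 3 + C (2 * w 1) * X ^ 2 + C (w 1 ^ 2) * X +
      C (w 3 + 2 * w 1 * w 2 + w 1 ^ 3) := by
  rw [starPoly, sum_fin_three_bool]
  simp only [Fintype.sum_prod_type, Fintype.sum_bool]
  simp [starWeight, starHang, map_ofNat C 2]
  ring

theorem branchPoly_monic (w : ℕ → ℚ) (P S : ℕ) : (branchPoly w P S).Monic := by
  refine (monic_X.mul (Monic.pow ?_ _)).mul (Monic.pow ?_ _)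
  · rw [pathPoly_eq]
    monicity!
  · rw [starPoly_eq]
    monicity!

theorem natDegree_branchPoly (w : ℕ → ℚ) (P S : ℕ) :
    (branchPoly w P S).natDegree = 3 * (P + S) + 1 := by
  have hp : (pathPoly w).Monic := by
    rw [pathPoly_eq]
    monicity!
  have hs : (starPoly w).Monic := by
    rw [starPoly_eq]
    monicity!
  have hp' : (pathPoly w).natDegree = 3 := by
    rw [pathPoly_eq]
    compute_degree!
  have hs' : (starPoly w).natDegree = 3 := by
    rw [starPoly_eq]
    compute_degree!
  rw [branchPoly, (monic_X.mul (hp.pow _)).natDegree_mul (hs.pow _),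
    monic_X.natDegree_mul (hp.pow _), hp.natDegree_pow, hs.natDegree_pow, hp', hs', natDegree_X]
  ring

/-- The leading coefficients of a product of monic polynomials perturbed by constants. -/
theorem coeff_prod_add_C {n d k : ℕ} (hd : 0 < d) (R : Fin n → ℚ[X]) (c : Fin n → ℚ)
    (hR : ∀ i, (R i).Monic) (hdeg : ∀ i, (R i).natDegree = d) (hk : n * d ≤ k + d) :
    (∏ i, (R i + C (c i))).coeff k =
      (∏ i, R i).coeff k + if k + d = n * d then ∑ i, c i else 0 := by
  have hmonic : ∀ t : Finset (Fin n), (∏ i ∈ t, R i).Monic := fun t =>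
    monic_prod_of_monic _ _ fun i _ => hR i
  have hnat : ∀ t : Finset (Fin n), (∏ i ∈ tᶜ, R i).natDegree + t.card * d = n * d := by
    intro t
    rw [natDegree_prod_of_monic _ _ fun i _ => hR i, Finset.sum_congr rfl fun i _ => hdeg i,
      Finset.sum_const, smul_eq_mul, ← add_mul, Finset.card_compl_add_card, Fintype.card_fin]
  have hterm : ∀ t : Finset (Fin n), t ≠ ∅ →
      ((∏ i ∈ t, C (c i)) * ∏ i ∈ tᶜ, R i).coeff k =
        if k + d = n * d ∧ t.card = 1 then ∏ i ∈ t, c i else 0 := by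
    intro t ht
    have hpos : 0 < t.card := Finset.card_pos.2 (Finset.nonempty_iff_ne_empty.2 ht)
    have hn := hnat t
    rw [← map_prod, coeff_C_mul]
    split_ifs with h
    · rw [h.2, one_mul] at hn
      rw [show k = (∏ i ∈ tᶜ, R i).natDegree by omega, (hmonic _).coeff_natDegree, mul_one]
    · rw [coeff_eq_zero_of_natDegree_lt, mul_zero]
      by_contra hlt
      refine h ?_
      have hle : t.card * d ≤ 1 * d := by omega
      have hc : t.card = 1 := le_antisymm (Nat.le_of_mul_le_mul_right hle hd) hpos
      rw [hc] at hn
      exact ⟨by omega, hc⟩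
  simp_rw [add_comm (R _)]
  rw [Fintype.prod_add, finsetSum_coeff, ← Finset.add_sum_erase _ _ (Finset.mem_univ ∅),
    Finset.sum_congr rfl fun t ht => hterm t (Finset.ne_of_mem_erase ht)]
  congr 1
  · simp
  · split_ifs with h
    · simp only [h, true_and]
      rw [← Finset.sum_filter]
      have : (Finset.univ.erase ∅).filter (fun t : Finset (Fin n) => t.card = 1) =
          Finset.powersetCard 1 Finset.univ := by
        ext t
        simp only [Finset.mem_filter, Finset.mem_erase, Finset.mem_univ, and_true,
          Finset.mem_powersetCard, Finset.subset_univ, true_and, and_iff_right_iff_imp]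
        rintro h rfl
        simp at h
      rw [this, Finset.powersetCard_one, Finset.sum_map]
      simp
    · simp [h]

theorem prod_branchPoly (w : ℕ → ℚ) {n : ℕ} (p s : Fin n → ℕ) :
    ∏ i, branchPoly w (p i) (s i) =
      X ^ n * pathPoly w ^ (∑ i, p i) * starPoly w ^ (∑ i, s i) := by
  simp only [branchPoly, Finset.prod_mul_distrib, Finset.prod_pow_eq_pow_sum, Fin.prod_const]

/-- The sum of marked weights for a large marked part, in terms of the parameters of the tree. -/
theorem sum_markedWeight_eq (w : ℕ → ℚ) {n : ℕ} {p s : Fin n → ℕ} {α k : ℕ} (hα : 0 < α)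
    (hn : 2 ≤ n) (hps : ∀ i, p i + s i = α) (hk : n * (3 * α + 1) ≤ k + (3 * α + 1)) :
    ((UPoly (TpsGraph n p s)).map (markedWeight w (k + 1))).sum =
      (X ^ n * pathPoly w ^ (∑ i, p i) * starPoly w ^ (∑ i, s i)).coeff k +
        if k + (3 * α + 1) = n * (3 * α + 1) then
          ∑ i, umbral w (branchPoly w (p i) (s i)) else 0 := by
  have hM : 3 * α + 1 < k + 1 := by
    have := Nat.mul_le_mul_right (3 * α + 1) hn
    omega
  rw [sum_markedWeight_UPoly w hα hps hM, coeff_X_mul,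
    coeff_prod_add_C (d := 3 * α + 1) (by omega) _ _ (fun i => branchPoly_monic _ _ _)
      (fun i => by rw [natDegree_branchPoly, hps]) hk, prod_branchPoly]

theorem sum_add_sum_eq_mul {n α : ℕ} {p s : Fin n → ℕ} (hps : ∀ i, p i + s i = α) :
    ∑ i, p i + ∑ i, s i = n * α := by
  rw [← Finset.sum_add_distrib, Finset.sum_congr rfl fun i _ => hps i]
  simp

/-- The number of edges is determined by the `U`-polynomial. -/
theorem card_UPoly_TpsGraph {n α : ℕ} {p s : Fin n → ℕ} (hps : ∀ i, p i + s i = α) :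
    (UPoly (TpsGraph n p s)).card = 2 ^ (n + 3 * (n * α)) := by
  rw [UPoly_TpsGraph, Multiset.card_map, Finset.card_val, Finset.card_univ,
    Fintype.card_of_bijective cfgCut_bijective, ← sum_add_sum_eq_mul hps]
  simp only [Fintype.card_pi, Fintype.card_bool, Finset.prod_const, Finset.card_univ,
    Fintype.card_sum, Fintype.card_sigma, Fintype.card_prod, Fintype.card_fin, ← Finset.sum_mul]
  congr 1
  ring

/-- Parts of size three count the hanging paths and stars. -/
theorem sum_markedWeight_three {n α : ℕ} {p s : Fin n → ℕ} (hα : 0 < α) (hn : 2 ≤ n)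
    (hps : ∀ i, p i + s i = α) :
    ((UPoly (TpsGraph n p s)).map
      (markedWeight (Pi.single 3 1) (n + 3 * (n * α) - 3 + 1))).sum = (n * α : ℕ) := by
  have hpos : 0 < n * α := Nat.mul_pos (by omega) hα
  have hd : n * (3 * α + 1) = n + 3 * (n * α) := by ring
  rw [sum_markedWeight_eq _ hα hn hps (by omega), if_neg (by omega), pathPoly_eq, starPoly_eq]
  have h1 : (Pi.single 3 1 : ℕ → ℚ) 1 = 0 := by simp
  have h2 : (Pi.single 3 1 : ℕ → ℚ) 2 = 0 := by simp
  have h3 : (Pi.single 3 1 : ℕ → ℚ) 3 = 1 := by simp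
  have hexp : (X ^ 3 + 1 : ℚ[X]) ^ (n * α) = expand ℚ 3 ((X + 1) ^ (n * α)) := by simp
  simp only [h1, h2, h3]
  norm_num
  rw [mul_assoc, ← pow_add, sum_add_sum_eq_mul hps, hexp,
    show n + 3 * (n * α) - 3 = (n * α - 1) * 3 + n by omega, coeff_X_pow_mul,
    coeff_expand_mul (by norm_num), coeff_X_add_one_pow, Nat.choose_symm (by omega)]
  simp

/-- Parts of size two count the hanging paths. -/
theorem sum_markedWeight_two {n α : ℕ} {p s : Fin n → ℕ} (hα : 0 < α) (hn : 2 ≤ n)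
    (hps : ∀ i, p i + s i = α) :
    ((UPoly (TpsGraph n p s)).map
      (markedWeight (Pi.single 2 1) (n + 3 * (n * α) - 2 + 1))).sum = (∑ i, p i : ℕ) := by
  have hpos : 0 < n * α := Nat.mul_pos (by omega) hα
  have hd : n * (3 * α + 1) = n + 3 * (n * α) := by ring
  rw [sum_markedWeight_eq _ hα hn hps (by omega), if_neg (by omega), pathPoly_eq, starPoly_eq]
  have h1 : (Pi.single 2 1 : ℕ → ℚ) 1 = 0 := by simp
  have h2 : (Pi.single 2 1 : ℕ → ℚ) 2 = 1 := by simp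
  have h3 : (Pi.single 2 1 : ℕ → ℚ) 3 = 0 := by simp
  have hsum := sum_add_sum_eq_mul hps
  simp only [h1, h2, h3]
  generalize ∑ i, p i = P at *
  generalize ∑ i, s i = S at *
  have hexp : X ^ n * (X ^ 3 + C 0 * X ^ 2 + C (1 + 0 ^ 2) * X +
      C (0 + 2 * 0 * 1 + 0 ^ 3)) ^ P * (X ^ 3 + C (2 * 0) * X ^ 2 + C (0 ^ 2) * X +
      C (0 + 2 * 0 * 1 + 0 ^ 3)) ^ S = X ^ (n + P + 3 * S) * expand ℚ 2 ((X + 1) ^ P) := by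
    rw [show (X ^ 3 + C 0 * X ^ 2 + C (1 + 0 ^ 2) * X + C (0 + 2 * 0 * 1 + 0 ^ 3) : ℚ[X]) =
      X * (X ^ 2 + 1) by simp; ring]
    simp only [mul_zero, zero_mul, map_zero, add_zero, map_pow, map_add, expand_X, map_one, mul_pow,
      ne_eq, OfNat.ofNat_ne_zero, not_false_eq_true, zero_pow]
    ring
  rw [hexp]
  obtain rfl | hP := Nat.eq_zero_or_pos P
  · simp [coeff_X_pow]
    omega
  · rw [show n + 3 * (n * α) - 2 = (P - 1) * 2 + (n + P + 3 * S) by omega, coeff_X_pow_mul,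
      coeff_expand_mul (by norm_num), coeff_X_add_one_pow, Nat.choose_symm (by omega)]
    simp

/-- The weights for which the functional `umbral` agrees with evaluation at `τ` on the branches,
up to a constant. -/
def evalWeight (τ : ℚ) : ℕ → ℚ
  | 0 => 0
  | 1 => -1
  | 2 => 0
  | 3 => 1
  | m + 4 => τ ^ (m + 4)

theorem umbral_eq_eval_add (w : ℕ → ℚ) (τ : ℚ) (hw : ∀ m, 4 ≤ m → w m = τ ^ m) (f : ℚ[X]) :
    umbral w f = f.eval τ + ∑ m ∈ Finset.range 4, f.coeff m * (w m - τ ^ m) := by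
  induction f using Polynomial.induction_on' with
  | add f g hf hg =>
    simp only [map_add, hf, hg, eval_add, coeff_add, add_mul, Finset.sum_add_distrib]
    ring
  | monomial m a =>
    rw [← C_mul_X_pow_eq_monomial, umbral_C_mul_X_pow]
    simp only [coeff_C_mul, coeff_X_pow, eval_mul, eval_C, eval_pow, eval_X, mul_ite, mul_one,
      mul_zero, ite_mul, zero_mul, Finset.sum_ite_eq', Finset.mem_range]
    split_ifs with h
    · ring
    · rw [hw m (by omega)]
      ring

theorem branchPoly_evalWeight (τ : ℚ) (P S : ℕ) :
    branchPoly (evalWeight τ) P S =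
      X ^ (P + S + 1) * ((X ^ 2 - X + 1) ^ P * ((X - 1) ^ 2) ^ S) := by
  rw [branchPoly, show pathPoly (evalWeight τ) = X * (X ^ 2 - X + 1) by
    rw [pathPoly_eq]; simp [evalWeight]; ring,
    show starPoly (evalWeight τ) = X * (X - 1) ^ 2 by
    rw [starPoly_eq]; simp [evalWeight, map_ofNat C 2]; ring, mul_pow, mul_pow]
  ring

theorem umbral_branchPoly_evalWeight (τ : ℚ) {P S α : ℕ} (hα : 2 ≤ α) (hPS : P + S = α) :
    umbral (evalWeight τ) (branchPoly (evalWeight τ) P S) =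
      τ ^ (α + 1) * ((τ ^ 2 - τ + 1) ^ P * ((τ - 1) ^ 2) ^ S) +
        if α = 2 then 1 - τ ^ 3 else 0 := by
  rw [umbral_eq_eval_add _ τ, branchPoly_evalWeight, hPS]
  · simp only [Finset.sum_range_succ, Finset.sum_range_zero, coeff_X_pow_mul']
    rw [if_neg (by omega), if_neg (by omega), if_neg (by omega)]
    split_ifs with h₁ h₂ h₂
    · subst h₂
      simp [coeff_zero_eq_eval_zero, evalWeight]
    · omega
    · omega
    · simp
  · rintro (_ | _ | _ | _ | m) hm
    iterate 4 omega
    rfl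

/-- Sequences with the same power-sum generating function are rearrangements of each other. -/
theorem exists_perm_of_sum_X_pow_eq {n : ℕ} {p p' : Fin n → ℕ}
    (h : ∑ i, (X : ℚ[X]) ^ p i = ∑ i, X ^ p' i) :
    ∃ σ : Equiv.Perm (Fin n), ∀ i, p i = p' (σ i) := by
  have hcard : ∀ m, Nonempty ({i // p i = m} ≃ {i // p' i = m}) := by
    intro m
    refine Fintype.card_eq.1 ?_
    have hm := congrArg (fun f : ℚ[X] => f.coeff m) h
    simp only [finsetSum_coeff, coeff_X_pow, Finset.sum_boole, Nat.cast_inj] at hm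
    simpa only [Fintype.card_subtype, eq_comm] using hm
  let e := fun m => (hcard m).some
  refine ⟨(Equiv.sigmaFiberEquiv p).symm.trans
    ((Equiv.sigmaCongrRight e).trans (Equiv.sigmaFiberEquiv p')), fun i => ?_⟩
  exact (e (p i) ⟨i, rfl⟩).2.symm

/-- The rational function `(τ² - τ + 1) / (τ - 1)²` takes distinct values at the integers `≥ 2`. -/
theorem evalRatio_injective :
    Function.Injective fun m : ℕ => (((m : ℚ) + 2) ^ 2 - (m + 2) + 1) / ((m + 2 - 1) ^ 2) := by
  intro a b h
  have ha : (0 : ℚ) ≤ a := Nat.cast_nonneg a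
  have hb : (0 : ℚ) ≤ b := Nat.cast_nonneg b
  have ha' : ((a : ℚ) + 2 - 1) ^ 2 ≠ 0 := pow_ne_zero _ (by linarith)
  have hb' : ((b : ℚ) + 2 - 1) ^ 2 ≠ 0 := pow_ne_zero _ (by linarith)
  have hab := (div_eq_div_iff ha' hb').1 h
  have hfac : ((b : ℚ) - a) * ((a + 2) * (b + 2) - 1) = 0 := by linear_combination hab
  have hne : ((a : ℚ) + 2) * (b + 2) - 1 ≠ 0 := by
    have := mul_nonneg ha hb
    exact ne_of_gt (by linarith)
  have := (mul_eq_zero.1 hfac).resolve_right hne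
  exact_mod_cast (sub_eq_zero.1 this).symm

/-- Evaluations of the branches determine the sequence up to rearrangement. -/
theorem exists_perm_of_sum_evalWeight_eq {n α : ℕ} {p s p' s' : Fin n → ℕ}
    (hps : ∀ i, p i + s i = α) (hps' : ∀ i, p' i + s' i = α)
    (h : ∀ τ : ℚ, ∑ i, τ ^ (α + 1) * ((τ ^ 2 - τ + 1) ^ p i * ((τ - 1) ^ 2) ^ s i) =
      ∑ i, τ ^ (α + 1) * ((τ ^ 2 - τ + 1) ^ p' i * ((τ - 1) ^ 2) ^ s' i)) :
    ∃ σ : Equiv.Perm (Fin n), ∀ i, p i = p' (σ i) := by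
  refine exists_perm_of_sum_X_pow_eq (eq_of_infinite_eval_eq _ _ ?_)
  refine (Set.infinite_range_of_injective evalRatio_injective).mono ?_
  rintro _ ⟨m, rfl⟩
  simp only [Set.mem_ofPred_eq, eval_finsetSum, eval_pow, eval_X]
  have hτ : ((m : ℚ) + 2) ≠ 0 := by positivity
  have hτ' : ((m : ℚ) + 2 - 1) ^ 2 ≠ 0 := by
    rw [show (m : ℚ) + 2 - 1 = m + 1 by ring]
    positivity
  have key := h (m + 2)
  generalize (m : ℚ) + 2 = τ at *
  have hterm : ∀ P S : ℕ, P + S = α →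
      τ ^ (α + 1) * ((τ ^ 2 - τ + 1) ^ P * ((τ - 1) ^ 2) ^ S) =
        τ ^ (α + 1) * ((τ - 1) ^ 2) ^ α * ((τ ^ 2 - τ + 1) / (τ - 1) ^ 2) ^ P := by
    rintro P S rfl
    rw [div_pow, pow_add ((τ - 1) ^ 2)]
    field_simp
  simp only [hterm _ _ (hps _), hterm _ _ (hps' _), ← Finset.mul_sum] at key
  exact mul_left_cancel₀ (mul_ne_zero (pow_ne_zero _ hτ) (pow_ne_zero _ hτ')) key

theorem exists_perm_of_UPoly_eq {n α : ℕ} {p s p' s' : Fin n → ℕ} (hα : 0 < α) (hn : 2 ≤ n)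
    (hps : ∀ i, p i + s i = α) (hps' : ∀ i, p' i + s' i = α)
    (hU : UPoly (TpsGraph n p s) = UPoly (TpsGraph n p' s')) :
    ∃ σ : Equiv.Perm (Fin n), ∀ i, p i = p' (σ i) := by
  have hP : ∑ i, p i = ∑ i, p' i := by
    have h := sum_markedWeight_two hα hn hps
    rw [hU, sum_markedWeight_two hα hn hps'] at h
    exact_mod_cast h.symm
  have hS : ∑ i, s i = ∑ i, s' i := by
    have := sum_add_sum_eq_mul hps
    have := sum_add_sum_eq_mul hps'
    omega
  have humbral : ∀ w : ℕ → ℚ, ∑ i, umbral w (branchPoly w (p i) (s i)) =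
      ∑ i, umbral w (branchPoly w (p' i) (s' i)) := by
    intro w
    have hk : (n - 1) * (3 * α + 1) + (3 * α + 1) = n * (3 * α + 1) := by
      rw [← Nat.succ_mul]
      congr 1
      omega
    have h := sum_markedWeight_eq w hα hn hps hk.ge
    rw [hU, sum_markedWeight_eq w hα hn hps' hk.ge, if_pos hk, if_pos hk, hP, hS] at h
    exact (add_left_cancel h).symm
  obtain rfl | hα₂ : α = 1 ∨ 2 ≤ α := by omega
  · refine exists_perm_of_sum_X_pow_eq ?_
    have hlin : ∀ q : Fin n → ℕ, (∀ i, q i ≤ 1) →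
        ∑ i, (X : ℚ[X]) ^ q i = (n : ℚ[X]) + (X - 1) * ((∑ i, q i : ℕ) : ℚ[X]) := by
      intro q hq
      have hterm : ∀ i, (X : ℚ[X]) ^ q i = 1 + (X - 1) * (q i : ℚ[X]) := by
        intro i
        obtain h | h := Nat.le_one_iff_eq_zero_or_eq_one.1 (hq i) <;> simp [h]
      simp only [hterm, Finset.sum_add_distrib, ← Finset.mul_sum, Nat.cast_sum]
      simp
    rw [hlin p fun i => by have := hps i; omega, hlin p' fun i => by have := hps' i; omega, hP]
  · refine exists_perm_of_sum_evalWeight_eq hps hps' fun τ => ?_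
    have h := humbral (evalWeight τ)
    simp only [umbral_branchPoly_evalWeight τ hα₂ (hps _),
      umbral_branchPoly_evalWeight τ hα₂ (hps' _), Finset.sum_add_distrib] at h
    exact add_right_cancel h

/-- The `U`-polynomial determines the tree `T(p, s)` when all branches have the same size. -/
theorem nonempty_iso_of_UPoly_eq {n n' α α' : ℕ} {p s : Fin n → ℕ} {p' s' : Fin n' → ℕ}
    (hα : 0 < α) (hα' : 0 < α') (hn : 2 ≤ n) (hn' : 2 ≤ n')
    (hps : ∀ i, p i + s i = α) (hps' : ∀ i, p' i + s' i = α')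
    (hU : UPoly (TpsGraph n p s) = UPoly (TpsGraph n' p' s')) :
    Nonempty (TpsGraph n p s ≃g TpsGraph n' p' s') := by
  have hedges : n + 3 * (n * α) = n' + 3 * (n' * α') := by
    have h := card_UPoly_TpsGraph hps
    rw [hU, card_UPoly_TpsGraph hps'] at h
    exact (Nat.pow_right_injective le_rfl h).symm
  have hmul : n * α = n' * α' := by
    have h := sum_markedWeight_three hα hn hps
    rw [hU, hedges, sum_markedWeight_three hα' hn' hps'] at h
    exact_mod_cast h.symm
  obtain rfl : n = n' := by omega
  obtain rfl : α = α' := Nat.eq_of_mul_eq_mul_left (by omega) hmul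
  obtain ⟨σ, hσ⟩ := exists_perm_of_UPoly_eq hα hn hps hps' hU
  refine nonempty_iso_of_perm σ hσ fun i => ?_
  have := hps i
  have := hps' (σ i)
  have := hσ i
  omega

/-- Two PTE-trees have the same `U`-polynomial if and only if they are isomorphic. -/
theorem PTE_trees_same_U_iff_iso {V V' : Type} [Fintype V] [Fintype V']
    (G : SimpleGraph V) (G' : SimpleGraph V')
    (hG : IsPTETree G) (hG' : IsPTETree G') :
    UPoly G = UPoly G' ↔ Nonempty (G ≃g G') := by
  obtain ⟨n, α, p, hα, ⟨hn, hp⟩, ⟨e⟩⟩ := hG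
  obtain ⟨n', α', p', hα', ⟨hn', hp'⟩, ⟨e'⟩⟩ := hG'
  refine ⟨fun h => ?_, fun ⟨f⟩ => UPoly_congr f⟩
  rw [UPoly_congr e, UPoly_congr e'] at h
  obtain ⟨f⟩ := nonempty_iso_of_UPoly_eq hα hα' hn hn' (fun i => Nat.add_sub_cancel' (hp i))
    (fun i => Nat.add_sub_cancel' (hp' i)) h
  exact ⟨(e.trans f).trans e'.symm⟩
end

section
/- The U_1-polynomial recognizes whether a tree is a PTE-tree: if T is a PTE-tree and T' is any tree with U_1(T) = U_1(T'), then T' is also a PTE-tree. -/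
open scoped Classical

/-- A rooted-tree presentation of a graph: a root, a parent map and a depth function such that the
edges of the graph are exactly the pairs `{v, parent v}` with `v` not the root. -/
structure Rooting {V : Type} (G : SimpleGraph V) where
  root : V
  parent : V → V
  depth : V → ℕ
  depth_parent : ∀ v, v ≠ root → depth v = depth (parent v) + 1
  adj_iff : ∀ u v, G.Adj u v ↔ (u ≠ root ∧ parent u = v) ∨ (v ≠ root ∧ parent v = u)

namespace Rooting

open Relation

variable {V : Type} {G : SimpleGraph V} (R : Rooting G)

/-- `R.Step a b` means that `b` is the parent of the non-root vertex `a`. -/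
def Step (a b : V) : Prop := a ≠ R.root ∧ R.parent a = b

/-- `R.IsDesc x v` means that `x` lies in the subtree rooted at `v`. -/
def IsDesc (x v : V) : Prop := ReflTransGen R.Step x v

variable {R}

theorem Step.depth_eq {a b : V} (h : R.Step a b) : R.depth a = R.depth b + 1 := by
  rw [R.depth_parent a h.1, h.2]

@[refl]
theorem IsDesc.refl (v : V) : R.IsDesc v v := ReflTransGen.refl

theorem IsDesc.eq_or_parent {x v : V} (h : R.IsDesc x v) :
    x = v ∨ (x ≠ R.root ∧ R.IsDesc (R.parent x) v) := by
  rcases ReflTransGen.cases_head h with h | ⟨y, hy, h⟩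
  · exact Or.inl h
  · exact Or.inr ⟨hy.1, by rw [hy.2]; exact h⟩

theorem isDesc_of_parent {x v : V} (hx : x ≠ R.root) (h : R.IsDesc (R.parent x) v) :
    R.IsDesc x v :=
  ReflTransGen.head ⟨hx, rfl⟩ h

theorem isDesc_parent {x : V} (hx : x ≠ R.root) : R.IsDesc x (R.parent x) :=
  ReflTransGen.single ⟨hx, rfl⟩

theorem IsDesc.depth_le {x v : V} (h : R.IsDesc x v) : R.depth v ≤ R.depth x := by
  induction h with
  | refl => exact le_rfl
  | tail _ h ih => have := h.depth_eq; omega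

theorem IsDesc.eq_of_depth_le {x v : V} (h : R.IsDesc x v) (hd : R.depth x ≤ R.depth v) :
    x = v := by
  rcases h.eq_or_parent with h | ⟨hx, h⟩
  · exact h
  · have := h.depth_le
    have := R.depth_parent x hx
    omega

theorem IsDesc.antisymm {x v : V} (h : R.IsDesc x v) (h' : R.IsDesc v x) : x = v :=
  h.eq_of_depth_le h'.depth_le

theorem IsDesc.total {x u v : V} (hu : R.IsDesc x u) (hv : R.IsDesc x v) :
    R.IsDesc u v ∨ R.IsDesc v u :=
  ReflTransGen.total_of_right_unique (fun _ _ _ h h' => h.2.symm.trans h'.2) hu hv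

theorem isDesc_root (x : V) : R.IsDesc x R.root := by
  induction hd : R.depth x generalizing x with
  | zero =>
    by_cases hx : x = R.root
    · subst hx; exact ReflTransGen.refl
    · have := R.depth_parent x hx; omega
  | succ d ih =>
    by_cases hx : x = R.root
    · subst hx; exact ReflTransGen.refl
    · have := R.depth_parent x hx
      exact isDesc_of_parent hx (ih _ (by omega))

theorem IsDesc.eq_root {v : V} (h : R.IsDesc R.root v) : v = R.root :=
  (isDesc_root v).antisymm h

theorem not_isDesc_parent {v : V} (hv : v ≠ R.root) : ¬ R.IsDesc (R.parent v) v := fun h => by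
  have := h.depth_le
  have := R.depth_parent v hv
  omega

theorem edge_injective {u v : V} (hu : u ≠ R.root) (hv : v ≠ R.root)
    (h : s(u, R.parent u) = s(v, R.parent v)) : u = v := by
  rcases Sym2.eq_iff.1 h with h | h
  · exact h.1
  · have h1 := R.depth_parent u hu
    have h2 := R.depth_parent v hv
    rw [h.2] at h1
    rw [← h.1] at h2
    omega

theorem adj_parent {v : V} (hv : v ≠ R.root) : G.Adj v (R.parent v) :=
  (R.adj_iff _ _).2 (Or.inl ⟨hv, rfl⟩)

/-- The graph left after deleting the edge above `v`. -/
abbrev cutAbove (R : Rooting G) (v : V) : SimpleGraph V := G.deleteEdges {s(v, R.parent v)}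

theorem cutAbove_adj_parent {v x : V} (hv : v ≠ R.root) (hx : x ≠ R.root) (hxv : x ≠ v) :
    (R.cutAbove v).Adj x (R.parent x) := by
  rw [SimpleGraph.deleteEdges_adj]
  exact ⟨adj_parent hx, fun h => hxv (edge_injective hx hv h)⟩

theorem cutAbove_reachable_of_isDesc {v x : V} (hv : v ≠ R.root) (h : R.IsDesc x v) :
    (R.cutAbove v).Reachable x v := by
  induction h using ReflTransGen.head_induction_on with
  | refl => exact SimpleGraph.Reachable.refl _
  | @head a b hab hb ih =>
    by_cases hav : a = v
    · subst hav; exact SimpleGraph.Reachable.refl _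
    · have := cutAbove_adj_parent hv hab.1 hav
      rw [hab.2] at this
      exact this.reachable.trans ih

theorem cutAbove_reachable_root {v x : V} (hv : v ≠ R.root) (h : ¬ R.IsDesc x v) :
    (R.cutAbove v).Reachable x R.root := by
  have hr := isDesc_root (R := R) x
  induction hr using ReflTransGen.head_induction_on with
  | refl => exact SimpleGraph.Reachable.refl _
  | @head a b hab hb ih =>
    have hav : a ≠ v := fun e => h (e ▸ ReflTransGen.refl)
    have := cutAbove_adj_parent hv hab.1 hav
    rw [hab.2] at this
    exact this.reachable.trans (ih fun hbv => h (ReflTransGen.head hab hbv))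

theorem isDesc_iff_of_cutAbove_adj {v x y : V} (h : (R.cutAbove v).Adj x y) :
    R.IsDesc x v ↔ R.IsDesc y v := by
  have key : ∀ a b, a ≠ R.root → R.parent a = b → s(a, b) ≠ s(v, R.parent v) →
      (R.IsDesc a v ↔ R.IsDesc b v) := by
    intro a b ha hab hne
    subst hab
    refine ⟨fun hd => ?_, isDesc_of_parent ha⟩
    rcases hd.eq_or_parent with rfl | hd
    · exact absurd rfl hne
    · exact hd.2
  rw [SimpleGraph.deleteEdges_adj] at h
  rcases (R.adj_iff x y).1 h.1 with ⟨hx, hxy⟩ | ⟨hy, hyx⟩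
  · exact key x y hx hxy h.2
  · exact (key y x hy hyx (by rw [Sym2.eq_swap]; exact h.2)).symm

theorem isDesc_iff_of_cutAbove_reachable {v x y : V} (h : (R.cutAbove v).Reachable x y) :
    R.IsDesc x v ↔ R.IsDesc y v := by
  obtain ⟨w⟩ := h
  induction w with
  | nil => exact Iff.rfl
  | cons hadj _ ih => exact (isDesc_iff_of_cutAbove_adj hadj).trans ih

theorem connected (R : Rooting G) : G.Connected := by
  have key : ∀ x, G.Reachable x R.root := fun x => by
    induction isDesc_root (R := R) x using ReflTransGen.head_induction_on with
    | refl => exact SimpleGraph.Reachable.refl _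
    | @head a b hab _ ih => exact (hab.2 ▸ adj_parent hab.1 : G.Adj a b).reachable.trans ih
  exact { preconnected := fun x y => (key x).trans (key y).symm, nonempty := ⟨R.root⟩ }

variable [Fintype V]

/-- The number of vertices of the subtree rooted at `v`. -/
noncomputable def weight (R : Rooting G) (v : V) : ℕ := (Finset.univ.filter (R.IsDesc · v)).card

/-- The children of `v`. -/
noncomputable def children (R : Rooting G) (v : V) : Finset V := Finset.univ.filter (R.Step · v)

theorem mem_children {u v : V} : u ∈ R.children v ↔ u ≠ R.root ∧ R.parent u = v :=
  Finset.mem_filter.trans (by simp [Step])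

theorem IsDesc.weight_le {x v : V} (h : R.IsDesc x v) : R.weight x ≤ R.weight v := by
  refine Finset.card_le_card fun y hy => ?_
  simp only [Finset.mem_filter, Finset.mem_univ, true_and] at hy ⊢
  exact hy.trans h

theorem IsDesc.weight_lt {x v : V} (h : R.IsDesc x v) (hne : x ≠ v) : R.weight x < R.weight v := by
  refine Finset.card_lt_card (Finset.ssubset_iff_of_subset (fun y hy => ?_) |>.2
    ⟨v, by simpa using IsDesc.refl v, fun hv => ?_⟩)
  · simp only [Finset.mem_filter, Finset.mem_univ, true_and] at hy ⊢
    exact hy.trans h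
  · exact hne (h.antisymm (by simpa using hv))

theorem weight_lt_weight_parent {v : V} (hv : v ≠ R.root) :
    R.weight v < R.weight (R.parent v) :=
  (isDesc_parent hv).weight_lt fun h => not_isDesc_parent hv (h ▸ ReflTransGen.refl)

theorem weight_eq (v : V) : R.weight v = 1 + ∑ u ∈ R.children v, R.weight u := by
  have hset : Finset.univ.filter (R.IsDesc · v) =
      insert v ((R.children v).biUnion fun u => Finset.univ.filter (R.IsDesc · u)) := by
    ext x
    simp only [Finset.mem_filter, Finset.mem_univ, true_and, Finset.mem_insert,
      Finset.mem_biUnion, mem_children]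
    constructor
    · intro h
      rcases ReflTransGen.cases_tail h with h | ⟨u, hxu, huv⟩
      · exact Or.inl h.symm
      · exact Or.inr ⟨u, huv, hxu⟩
    · rintro (rfl | ⟨u, huv, hxu⟩)
      · exact ReflTransGen.refl
      · exact ReflTransGen.tail hxu huv
  have hsib : ∀ u u', u ∈ R.children v → u' ∈ R.children v → R.IsDesc u u' → u = u' := by
    intro u u' hu hu' h
    rw [mem_children] at hu hu'
    refine h.eq_of_depth_le ?_
    rw [R.depth_parent u hu.1, R.depth_parent u' hu'.1, hu.2, hu'.2]
  rw [weight, hset, Finset.card_insert_of_notMem, Finset.card_biUnion, add_comm]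
  · rfl
  · intro u hu u' hu' hne
    refine Finset.disjoint_left.2 fun x hx hx' => ?_
    simp only [Finset.mem_filter, Finset.mem_univ, true_and] at hx hx'
    rcases hx.total hx' with h | h
    · exact hne (hsib _ _ hu hu' h)
    · exact hne (hsib _ _ hu' hu h).symm
  · simp only [Finset.mem_biUnion, mem_children, Finset.mem_filter, Finset.mem_univ, true_and,
      not_exists, not_and]
    rintro u ⟨hu, rfl⟩
    exact not_isDesc_parent hu

theorem weight_unique (f : V → ℕ) (hf : ∀ v, f v = 1 + ∑ u ∈ R.children v, f u) (v : V) :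
    f v = R.weight v := by
  induction hw : R.weight v using Nat.strong_induction_on generalizing v with
  | _ n ih =>
    rw [hf, ← hw, weight_eq]
    congr 1
    refine Finset.sum_congr rfl fun u hu => ih _ ?_ _ rfl
    rw [mem_children] at hu
    have := weight_lt_weight_parent hu.1
    rw [hu.2] at this
    omega

theorem componentSizes_eq_singleton (hG : G.Connected) :
    componentSizes G = {Fintype.card V} := by
  have := hG.nonempty
  have hall : ∀ c : G.ConnectedComponent, c = G.connectedComponentMk (Classical.arbitrary V) := by
    intro c
    induction c using SimpleGraph.ConnectedComponent.ind with
    | h x => exact SimpleGraph.ConnectedComponent.sound (hG.preconnected _ _)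
  have huniv : (Finset.univ : Finset G.ConnectedComponent) =
      {G.connectedComponentMk (Classical.arbitrary V)} := by
    ext c; simpa using hall c
  have hsupp : (G.connectedComponentMk (Classical.arbitrary V)).supp = Set.univ := by
    ext x
    simpa using (hall (G.connectedComponentMk x))
  rw [componentSizes, huniv, Finset.singleton_val, Multiset.map_singleton, hsupp]
  simp

theorem componentSizes_cutAbove {v : V} (hv : v ≠ R.root) :
    componentSizes (R.cutAbove v) = {R.weight v, Fintype.card V - R.weight v} := by
  have hmem : ∀ x, R.IsDesc x v →
      (R.cutAbove v).connectedComponentMk x = (R.cutAbove v).connectedComponentMk v := fun x hx =>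
    SimpleGraph.ConnectedComponent.sound (cutAbove_reachable_of_isDesc hv hx)
  have hnmem : ∀ x, ¬ R.IsDesc x v →
      (R.cutAbove v).connectedComponentMk x = (R.cutAbove v).connectedComponentMk R.root :=
    fun x hx => SimpleGraph.ConnectedComponent.sound (cutAbove_reachable_root hv hx)
  have hroot : ¬ R.IsDesc R.root v := fun h => hv h.eq_root
  have hne : (R.cutAbove v).connectedComponentMk v ≠
      (R.cutAbove v).connectedComponentMk R.root := fun h =>
    hroot ((isDesc_iff_of_cutAbove_reachable (SimpleGraph.ConnectedComponent.exact h)).1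
      ReflTransGen.refl)
  have huniv : ∀ inst : Fintype (R.cutAbove v).ConnectedComponent, (@Finset.univ _ inst) =
      {(R.cutAbove v).connectedComponentMk v, (R.cutAbove v).connectedComponentMk R.root} := by
    intro inst
    ext c
    simp only [Finset.mem_univ, Finset.mem_insert, Finset.mem_singleton, true_iff]
    induction c using SimpleGraph.ConnectedComponent.ind with
    | h x =>
      by_cases hx : R.IsDesc x v
      · exact Or.inl (hmem x hx)
      · exact Or.inr (hnmem x hx)
  have hsupp : ((R.cutAbove v).connectedComponentMk v).supp =
      ↑(Finset.univ.filter (R.IsDesc · v)) := by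
    ext x
    simp only [SimpleGraph.ConnectedComponent.mem_supp_iff, Finset.coe_filter, Finset.mem_univ,
      true_and, Set.mem_ofPred_eq]
    refine ⟨fun h => ?_, hmem x⟩
    exact (isDesc_iff_of_cutAbove_reachable (SimpleGraph.ConnectedComponent.exact h)).2
      ReflTransGen.refl
  have hsupp' : ((R.cutAbove v).connectedComponentMk R.root).supp =
      ↑(Finset.univ.filter (R.IsDesc · v))ᶜ := by
    ext x
    simp only [SimpleGraph.ConnectedComponent.mem_supp_iff, Finset.coe_filter, Finset.mem_univ,
      true_and, Set.mem_ofPred_eq, Finset.coe_compl, Set.mem_compl_iff]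
    refine ⟨fun h hx => hne ((hmem x hx).symm.trans h), hnmem x⟩
  rw [componentSizes, huniv, Finset.insert_val_of_notMem (by simpa using hne),
    Finset.singleton_val, Multiset.map_cons, Multiset.map_singleton, hsupp, hsupp',
    Nat.card_coe_set_eq, Nat.card_coe_set_eq, Set.ncard_coe_finset, Set.ncard_coe_finset,
    Finset.card_compl]
  rfl

theorem edgeFinset_eq (R : Rooting G) :
    G.edgeFinset = (Finset.univ.erase R.root).image fun v => s(v, R.parent v) := by
  ext e
  induction e using Sym2.ind with
  | _ x y =>
    simp only [SimpleGraph.mem_edgeFinset, SimpleGraph.mem_edgeSet, R.adj_iff, Finset.mem_image,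
      Finset.mem_erase, Finset.mem_univ, and_true]
    constructor
    · rintro (⟨h, rfl⟩ | ⟨h, rfl⟩)
      · exact ⟨x, h, rfl⟩
      · exact ⟨y, h, Sym2.eq_swap⟩
    · rintro ⟨v, hv, h⟩
      rcases Sym2.eq_iff.1 h with ⟨rfl, rfl⟩ | ⟨rfl, rfl⟩
      · exact Or.inl ⟨hv, rfl⟩
      · exact Or.inr ⟨hv, rfl⟩

theorem UkPoly_one (R : Rooting G) :
    UkPoly G 1 = {Fintype.card V} ::ₘ (Finset.univ.erase R.root).val.map
      fun v => {R.weight v, Fintype.card V - R.weight v} := by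
  have hset : (G.edgeFinset.powerset.filter fun A => A.card ≤ 1) =
      insert ∅ ((Finset.univ.erase R.root).image fun v => {s(v, R.parent v)}) := by
    ext A
    simp only [Finset.mem_filter, Finset.mem_powerset, Finset.mem_insert, Finset.mem_image,
      edgeFinset_eq R]
    constructor
    · rintro ⟨hA, hcard⟩
      rcases A.eq_empty_or_nonempty with h | ⟨e, he⟩
      · exact Or.inl h
      · obtain ⟨v, hv, hve⟩ := Finset.mem_image.1 (hA he)
        have := Finset.card_le_one.1 hcard
        refine Or.inr ⟨v, hv, ?_⟩
        rw [hve]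
        exact (Finset.singleton_subset_iff.2 he).antisymm fun e' he' =>
          Finset.mem_singleton.2 (this _ he' _ he)
    · rintro (rfl | ⟨v, hv, rfl⟩)
      · exact ⟨by simp, by simp⟩
      · exact ⟨Finset.singleton_subset_iff.2 (Finset.mem_image_of_mem _ hv), by simp⟩
  rw [UkPoly, hset, Finset.insert_val_of_notMem (by simp), Multiset.pure_def]
  change Multiset.map _ (Multiset.bind _ _) = _
  rw [Multiset.bind_singleton, Multiset.map_map, Multiset.map_cons,
    Finset.image_val_of_injOn, Multiset.map_map]
  · congr 1
    · simpa using componentSizes_eq_singleton R.connected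
    · refine Multiset.map_congr rfl fun v hv => ?_
      have hv' : v ≠ R.root := (Finset.mem_erase.1 hv).1
      simpa using componentSizes_cutAbove hv'
  · intro u hu v hv h
    exact edge_injective (R := R) (by simpa using hu) (by simpa using hv)
      (Finset.singleton_injective h)

end Rooting

namespace Rooting

variable {V W : Type} {G : SimpleGraph V} {H : SimpleGraph W}

/-- Transport of a rooting along a graph isomorphism. -/
def comap (R : Rooting H) (e : G ≃g H) : Rooting G where
  root := e.symm R.root
  parent v := e.symm (R.parent (e v))
  depth v := R.depth (e v)
  depth_parent v hv := by
    have : e v ≠ R.root := fun h => hv (by rw [← h]; simp)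
    simpa using R.depth_parent _ this
  adj_iff u v := by
    have key : ∀ a b, (a ≠ e.symm R.root ∧ e.symm (R.parent (e a)) = b) ↔
        (e a ≠ R.root ∧ R.parent (e a) = e b) := fun a b => by
      rw [← e.injective.ne_iff, ← e.injective.eq_iff]
      simp
    rw [← e.map_adj_iff, R.adj_iff, key, key]

theorem weight_comap [Fintype V] [Fintype W] (R : Rooting H) (e : G ≃g H) (v : V) :
    (R.comap e).weight v = R.weight (e v) := by
  refine ((R.comap e).weight_unique (fun v => R.weight (e v)) (fun v => ?_) v).symm
  rw [weight_eq]
  congr 1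
  refine (Finset.sum_equiv e.toEquiv (fun u => ?_) fun u _ => rfl).symm
  simp only [mem_children, comap]
  rw [← e.injective.ne_iff, ← e.injective.eq_iff]
  simp

theorem IsDesc.dist_add_depth_le {R : Rooting G} {x v : V} (h : R.IsDesc x v) :
    G.dist v x + R.depth v ≤ R.depth x := by
  induction h using Relation.ReflTransGen.head_induction_on with
  | refl => simp
  | @head a b hab _ ih =>
    have h1 := R.connected.dist_triangle (u := v) (v := b) (w := a)
    have hadj : G.Adj b a := (hab.2 ▸ R.adj_parent hab.1 : G.Adj a b).symm
    rw [SimpleGraph.dist_eq_one_iff_adj.2 hadj] at h1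
    have := hab.depth_eq
    omega

variable [Fintype V]

/-- The multiset of subtree sizes at the non-root vertices. -/
noncomputable def weights (R : Rooting G) : Multiset ℕ :=
  (Finset.univ.erase R.root).val.map R.weight

theorem count_weights (R : Rooting G) (a : ℕ) :
    R.weights.count a = ((Finset.univ.erase R.root).filter fun v => R.weight v = a).card := by
  rw [weights, Multiset.count_map]
  simp only [eq_comm (a := a)]
  rfl

theorem weights_comap [Fintype W] (R : Rooting H) (e : G ≃g H) :
    (R.comap e).weights = R.weights := by
  have : (Finset.univ.erase R.root) =
      (Finset.univ.erase (R.comap e).root).map e.toEquiv.toEmbedding := by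
    ext x
    simp [comap]
  rw [weights, weights, this, Finset.map_val, Multiset.map_map]
  exact Multiset.map_congr rfl fun v _ => weight_comap R e v

/-- The rooting of a tree at a vertex, with the distance to the root as depth. -/
theorem exists_of_isTree (hG : G.IsTree) (r : V) :
    ∃ R : Rooting G, R.root = r ∧ R.depth = G.dist r := by
  have hpar : ∀ v, ∃ u, v ≠ r → G.Adj v u ∧ G.dist r v = G.dist r u + 1 := by
    intro v
    by_cases hv : v = r
    · exact ⟨v, fun h => absurd hv h⟩
    obtain ⟨p, hp⟩ := hG.connected.exists_walk_length_eq_dist v r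
    cases p with
    | nil => exact absurd rfl hv
    | @cons _ u _ h q =>
      refine ⟨u, fun _ => ⟨h, ?_⟩⟩
      have h1 := SimpleGraph.dist_le q
      have h2 := hG.connected.dist_triangle (u := r) (v := u) (w := v)
      rw [(SimpleGraph.dist_eq_one_iff_adj).2 h.symm] at h2
      rw [SimpleGraph.Walk.length_cons] at hp
      rw [SimpleGraph.dist_comm (u := r)] at h2 ⊢
      rw [SimpleGraph.dist_comm (u := r)] at h2 ⊢
      omega
  choose par hpar using hpar
  have hinj : Set.InjOn (fun v => s(v, par v)) (Finset.univ.erase r : Finset V) := by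
    intro u hu v hv h
    have hu := hpar u (by simpa using hu)
    have hv := hpar v (by simpa using hv)
    rcases Sym2.eq_iff.1 h with h | ⟨h, h'⟩
    · exact h.1
    · rw [h'] at hu
      rw [← h] at hv
      omega
  have hsub : (Finset.univ.erase r).image (fun v => s(v, par v)) ⊆ G.edgeFinset := by
    intro e he
    obtain ⟨v, hv, rfl⟩ := Finset.mem_image.1 he
    simpa using (hpar v (by simpa using hv)).1
  have heq := Finset.eq_of_subset_of_card_le hsub (by
    rw [Finset.card_image_of_injOn hinj, Finset.card_erase_of_mem (Finset.mem_univ _),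
      Finset.card_univ, ← hG.card_edgeFinset]
    simp)
  refine ⟨⟨r, par, G.dist r, fun v hv => (hpar v hv).2, fun u v => ⟨fun h => ?_, ?_⟩⟩, rfl, rfl⟩
  · have : s(u, v) ∈ G.edgeFinset := by simpa using h
    rw [← heq] at this
    obtain ⟨x, hx, hxe⟩ := Finset.mem_image.1 this
    rcases Sym2.eq_iff.1 hxe with ⟨rfl, rfl⟩ | ⟨rfl, rfl⟩
    · exact Or.inl ⟨by simpa using hx, rfl⟩
    · exact Or.inr ⟨by simpa using hx, rfl⟩
  · rintro (⟨h, rfl⟩ | ⟨h, rfl⟩)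
    · exact (hpar u h).1
    · exact (hpar v h).1.symm

/-- Every tree can be rooted at a centroid: a vertex all of whose branches contain at most half of
the vertices. -/
theorem exists_centroid (hG : G.IsTree) :
    ∃ R : Rooting G, ∀ v, v ≠ R.root → 2 * R.weight v ≤ Fintype.card V := by
  have := hG.connected.nonempty
  obtain ⟨r, -, hr⟩ := Finset.exists_min_image Finset.univ (fun r => ∑ x, G.dist r x)
    Finset.univ_nonempty
  obtain ⟨R, rfl, hdepth⟩ := exists_of_isTree hG r
  refine ⟨R, fun v hv => ?_⟩
  induction hd : R.depth v generalizing v with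
  | zero => have := R.depth_parent v hv; omega
  | succ d ih =>
    by_cases hp : R.parent v = R.root
    · have hadj : G.Adj v R.root := hp ▸ adj_parent hv
      have hv1 : R.depth v = 1 := by
        rw [R.depth_parent v hv, hp, hdepth, SimpleGraph.dist_self]
      have hle : ∀ x, G.dist v x + 2 * (if R.IsDesc x v then 1 else 0) ≤ G.dist R.root x + 1 := by
        intro x
        split_ifs with hx
        · have := hx.dist_add_depth_le
          rw [hdepth] at this hv1
          omega
        · have := hG.connected.dist_triangle (u := v) (v := R.root) (w := x)
          rw [SimpleGraph.dist_eq_one_iff_adj.2 hadj] at this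
          omega
      have hsum := Finset.sum_le_sum fun x (_ : x ∈ Finset.univ) => hle x
      rw [Finset.sum_add_distrib, Finset.sum_add_distrib, ← Finset.mul_sum,
        Finset.sum_boole] at hsum
      have := hr v (Finset.mem_univ _)
      simp only [Finset.sum_const, Finset.card_univ, smul_eq_mul, mul_one, Nat.cast_id] at hsum
      unfold weight
      omega
    · have := R.depth_parent v hv
      have := weight_lt_weight_parent hv
      have := ih _ hp (by omega)
      omega

/-- The `U_1`-polynomial determines the order of a tree and the subtree sizes of a rooting at a
centroid. -/
theorem weights_eq_of_UkPoly_eq [Fintype W] (R : Rooting G) (S : Rooting H)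
    (hR : ∀ v, v ≠ R.root → 2 * R.weight v ≤ Fintype.card V)
    (hS : ∀ v, v ≠ S.root → 2 * S.weight v ≤ Fintype.card W)
    (h : UkPoly G 1 = UkPoly H 1) :
    Fintype.card V = Fintype.card W ∧ R.weights = S.weights := by
  rw [UkPoly_one R, UkPoly_one S] at h
  have hcard : Fintype.card V = Fintype.card W := by
    have hmem := h ▸ Multiset.mem_cons_self _ _
    rcases Multiset.mem_cons.1 hmem with h | h
    · simpa using h
    · obtain ⟨v, -, hv⟩ := Multiset.mem_map.1 h
      simpa using congrArg Multiset.card hv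
  refine ⟨hcard, ?_⟩
  rw [← hcard, Multiset.cons_inj_right] at h
  have h' := congrArg (Multiset.map fun s => s.fold min (Fintype.card V)) h
  rw [Multiset.map_map, Multiset.map_map] at h'
  have key : ∀ {U : Type} {K : SimpleGraph U} [Fintype U] (Q : Rooting K),
      (∀ v, v ≠ Q.root → 2 * Q.weight v ≤ Fintype.card V) →
      (Finset.univ.erase Q.root).val.map ((fun s : Multiset ℕ => s.fold min (Fintype.card V)) ∘
        fun v => {Q.weight v, Fintype.card V - Q.weight v}) = Q.weights := by
    intro U K _ Q hQ
    refine Multiset.map_congr rfl fun v hv => ?_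
    have := hQ v (Finset.mem_erase.1 hv).1
    simp only [Function.comp_apply, Multiset.insert_eq_cons, Multiset.fold_cons_left,
      Multiset.fold_singleton]
    omega
  rwa [key R hR, key S (hcard ▸ hS)] at h'

end Rooting

section Tps

variable {n : ℕ} {p s : Fin n → ℕ}

/-- The parent map of `T(p,s)` rooted at the central vertex. -/
def tpsParent : Vtx n p s → Vtx n p s
  | Sum.inl _ => Sum.inl ()
  | Sum.inr (Sum.inl _) => Sum.inl ()
  | Sum.inr (Sum.inr (Sum.inl ⟨i, _, 0⟩)) => Sum.inr (Sum.inl i)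
  | Sum.inr (Sum.inr (Sum.inl ⟨i, j, 1⟩)) => Sum.inr (Sum.inr (Sum.inl ⟨i, j, 0⟩))
  | Sum.inr (Sum.inr (Sum.inl ⟨i, j, 2⟩)) => Sum.inr (Sum.inr (Sum.inl ⟨i, j, 1⟩))
  | Sum.inr (Sum.inr (Sum.inr ⟨i, _, 0⟩)) => Sum.inr (Sum.inl i)
  | Sum.inr (Sum.inr (Sum.inr ⟨i, j, 1⟩)) => Sum.inr (Sum.inr (Sum.inr ⟨i, j, 0⟩))
  | Sum.inr (Sum.inr (Sum.inr ⟨i, j, 2⟩)) => Sum.inr (Sum.inr (Sum.inr ⟨i, j, 0⟩))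

/-- The depth function of `T(p,s)` rooted at the central vertex. -/
def tpsDepth : Vtx n p s → ℕ
  | Sum.inl _ => 0
  | Sum.inr (Sum.inl _) => 1
  | Sum.inr (Sum.inr (Sum.inl ⟨_, _, 0⟩)) => 2
  | Sum.inr (Sum.inr (Sum.inl ⟨_, _, 1⟩)) => 3
  | Sum.inr (Sum.inr (Sum.inl ⟨_, _, 2⟩)) => 4
  | Sum.inr (Sum.inr (Sum.inr ⟨_, _, 0⟩)) => 2
  | Sum.inr (Sum.inr (Sum.inr ⟨_, _, 1⟩)) => 3
  | Sum.inr (Sum.inr (Sum.inr ⟨_, _, 2⟩)) => 3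

/-- The subtree sizes of `T(p,s)` rooted at the central vertex. -/
def tpsWeight : Vtx n p s → ℕ
  | Sum.inl _ => 1 + ∑ i, (1 + 3 * (p i + s i))
  | Sum.inr (Sum.inl i) => 1 + 3 * (p i + s i)
  | Sum.inr (Sum.inr (Sum.inl ⟨_, _, 0⟩)) => 3
  | Sum.inr (Sum.inr (Sum.inl ⟨_, _, 1⟩)) => 2
  | Sum.inr (Sum.inr (Sum.inl ⟨_, _, 2⟩)) => 1
  | Sum.inr (Sum.inr (Sum.inr ⟨_, _, 0⟩)) => 3
  | Sum.inr (Sum.inr (Sum.inr ⟨_, _, 1⟩)) => 1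
  | Sum.inr (Sum.inr (Sum.inr ⟨_, _, 2⟩)) => 1

theorem tRel_iff (x y : Vtx n p s) :
    TRel n p s x y ↔ y ≠ Sum.inl () ∧ tpsParent y = x := by
  constructor
  · rintro (i | ⟨i, j⟩ | ⟨i, j, l⟩ | ⟨i, j⟩ | ⟨i, j, l⟩)
    · simp [tpsParent]
    · simp [tpsParent]
    · fin_cases l <;> simp [tpsParent]
    · simp [tpsParent]
    · fin_cases l <;> simp [tpsParent]
  · rintro ⟨hy, rfl⟩
    rcases y with _ | i | ⟨i, j, l⟩ | ⟨i, j, l⟩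
    · exact absurd rfl hy
    · exact TRel.core i
    · fin_cases l
      · exact TRel.pathRoot i j
      · exact TRel.pathEdge i j 0
      · exact TRel.pathEdge i j 1
    · fin_cases l
      · exact TRel.starRoot i j
      · exact TRel.starEdge i j 0
      · exact TRel.starEdge i j 1

theorem tpsDepth_tpsParent (y : Vtx n p s) (hy : y ≠ Sum.inl ()) :
    tpsDepth y = tpsDepth (tpsParent y) + 1 := by
  rcases y with _ | i | ⟨i, j, l⟩ | ⟨i, j, l⟩
  · exact absurd rfl hy
  · rfl
  · fin_cases l <;> rfl
  · fin_cases l <;> rfl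

/-- The rooting of `T(p,s)` at the central vertex. -/
def tpsRooting (n : ℕ) (p s : Fin n → ℕ) : Rooting (TpsGraph n p s) where
  root := Sum.inl ()
  parent := tpsParent
  depth := tpsDepth
  depth_parent := tpsDepth_tpsParent
  adj_iff u v := by
    rw [TpsGraph, SimpleGraph.fromRel_adj, tRel_iff, tRel_iff]
    constructor
    · rintro ⟨-, h | h⟩
      · exact Or.inr h
      · exact Or.inl h
    · intro h
      refine ⟨?_, h.symm⟩
      rintro rfl
      have h : u ≠ Sum.inl () ∧ tpsParent u = u := by simpa using h
      have := tpsDepth_tpsParent u h.1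
      rw [h.2] at this
      omega

theorem sum_vtx (f : Vtx n p s → ℕ) :
    ∑ x, f x = f (Sum.inl ()) + ∑ i, (f (Sum.inr (Sum.inl i)) +
      ((∑ j, ∑ k, f (Sum.inr (Sum.inr (Sum.inl ⟨i, j, k⟩)))) +
        ∑ j, ∑ k, f (Sum.inr (Sum.inr (Sum.inr ⟨i, j, k⟩))))) := by
  simp only [Fintype.sum_sum_type, Fintype.sum_sigma, Fintype.sum_prod_type,
    Finset.sum_add_distrib, Finset.univ_unique, Finset.sum_singleton]

theorem sum_vtx_erase (f : Vtx n p s → ℕ) :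
    ∑ x ∈ Finset.univ.erase (Sum.inl ()), f x = ∑ i, (f (Sum.inr (Sum.inl i)) +
      ((∑ j, ∑ k, f (Sum.inr (Sum.inr (Sum.inl ⟨i, j, k⟩)))) +
        ∑ j, ∑ k, f (Sum.inr (Sum.inr (Sum.inr ⟨i, j, k⟩))))) := by
  have h := Finset.add_sum_erase Finset.univ f (Finset.mem_univ (Sum.inl ()))
  rw [sum_vtx] at h
  exact Nat.add_left_cancel h

theorem card_vtx : Fintype.card (Vtx n p s) = 1 + ∑ i, (1 + 3 * (p i + s i)) := by
  rw [← Finset.card_univ, Finset.card_eq_sum_ones, sum_vtx]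
  simp only [Finset.sum_const, Finset.card_univ, Fintype.card_fin, smul_eq_mul, mul_one]
  congr 1
  exact Finset.sum_congr rfl fun i _ => by ring

/-- The children of the vertices of `T(p,s)` other than the central vertex and the `v_i`. -/
def tpsLowerChildren : Vtx n p s → Finset (Vtx n p s)
  | Sum.inr (Sum.inr (Sum.inl ⟨i, j, 0⟩)) => {Sum.inr (Sum.inr (Sum.inl ⟨i, j, 1⟩))}
  | Sum.inr (Sum.inr (Sum.inl ⟨i, j, 1⟩)) => {Sum.inr (Sum.inr (Sum.inl ⟨i, j, 2⟩))}
  | Sum.inr (Sum.inr (Sum.inr ⟨i, j, 0⟩)) =>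
      {Sum.inr (Sum.inr (Sum.inr ⟨i, j, 1⟩)), Sum.inr (Sum.inr (Sum.inr ⟨i, j, 2⟩))}
  | _ => ∅

theorem tps_children_eq_lowerChildren
    (v : (Σ i : Fin n, Fin (p i) × Fin 3) ⊕ (Σ i : Fin n, Fin (s i) × Fin 3)) :
    (tpsRooting n p s).children (Sum.inr (Sum.inr v)) =
      tpsLowerChildren (Sum.inr (Sum.inr v)) := by
  ext u
  rw [Rooting.mem_children]
  rcases v with ⟨i, j, l⟩ | ⟨i, j, l⟩ <;> fin_cases l <;>
    rcases u with _ | i' | ⟨i', j', l'⟩ | ⟨i', j', l'⟩ <;> (try fin_cases l') <;>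
    simp [tpsRooting, tpsParent, tpsLowerChildren] <;> grind

theorem tps_weight (v : Vtx n p s) : (tpsRooting n p s).weight v = tpsWeight v := by
  refine (Rooting.weight_unique _ (fun v => ?_) v).symm
  have hch : (tpsRooting n p s).children v =
      (Finset.univ.erase (Sum.inl ())).filter fun u => tpsParent u = v := by
    ext u
    rw [Rooting.mem_children]
    simp [tpsRooting]
  rcases v with _ | i | v
  · rw [hch, Finset.sum_filter, sum_vtx_erase]
    simp [Fin.sum_univ_three, tpsParent, tpsWeight]
  · rw [hch, Finset.sum_filter, sum_vtx_erase]
    simp only [Fin.sum_univ_three, tpsParent, tpsWeight]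
    simp [Finset.sum_add_distrib]
    ring
  · rw [tps_children_eq_lowerChildren]
    rcases v with ⟨i, j, l⟩ | ⟨i, j, l⟩ <;> fin_cases l <;> simp [tpsLowerChildren, tpsWeight]

theorem sum_tpsWeight (g : ℕ → ℕ) :
    ∑ x ∈ Finset.univ.erase (Sum.inl ()), g (tpsWeight (n := n) (p := p) (s := s) x) =
      ∑ i, (g (1 + 3 * (p i + s i)) + (p i * (g 3 + g 2 + g 1) + s i * (g 3 + g 1 + g 1))) := by
  rw [sum_vtx_erase]
  simp [Fin.sum_univ_three, tpsWeight]

theorem count_weights_tps (a : ℕ) : (tpsRooting n p s).weights.count a =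
    ∑ i, ((if 1 + 3 * (p i + s i) = a then 1 else 0) +
      (p i * ((if 3 = a then 1 else 0) + (if 2 = a then 1 else 0) + (if 1 = a then 1 else 0)) +
       s i * ((if 3 = a then 1 else 0) + (if 1 = a then 1 else 0) + (if 1 = a then 1 else 0)))) := by
  rw [← sum_tpsWeight fun b => if b = a then 1 else 0, Rooting.count_weights, Finset.card_filter]
  simp only [tps_weight]
  congr!

end Tps

namespace Rooting

variable {V W : Type} {G : SimpleGraph V} {H : SimpleGraph W} [Fintype V] [Fintype W]

/-- A map of rooted trees of the same order that is injective on siblings is an isomorphism. -/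
theorem nonempty_iso_of_map (R : Rooting G) (S : Rooting H) (φ : V → W)
    (hcard : Fintype.card V = Fintype.card W) (hroot : φ R.root = S.root)
    (hstep : ∀ x, x ≠ R.root → S.Step (φ x) (φ (R.parent x)))
    (hsib : ∀ x y, x ≠ R.root → y ≠ R.root → R.parent x = R.parent y → φ x = φ y → x = y) :
    Nonempty (G ≃g H) := by
  have hiff : ∀ x, φ x = S.root ↔ x = R.root := fun x =>
    ⟨fun h => by_contra fun hx => (hstep x hx).1 h, fun h => h ▸ hroot⟩
  have hinj : ∀ d x y, R.depth x = d → φ x = φ y → x = y := by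
    intro d
    induction d with
    | zero =>
      intro x y hx h
      have hx : x = R.root := by_contra fun hne => by have := R.depth_parent x hne; omega
      rw [hx, hroot, eq_comm, hiff] at h
      rw [hx, h]
    | succ d ih =>
      intro x y hx h
      by_cases hxr : x = R.root
      · rw [hxr, hroot, eq_comm, hiff] at h
        rw [hxr, h]
      by_cases hyr : y = R.root
      · rw [hyr, hroot, hiff] at h
        rw [hyr, h]
      refine hsib x y hxr hyr (ih _ _ ?_ ?_) h
      · have := R.depth_parent x hxr; omega
      · rw [← (hstep x hxr).2, ← (hstep y hyr).2, h]
  have hinj : Function.Injective φ := fun x y h => hinj _ x y rfl h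
  have hbij : Function.Bijective φ := (Fintype.bijective_iff_injective_and_card φ).2 ⟨hinj, hcard⟩
  have hpar : ∀ a b, (φ a ≠ S.root ∧ S.parent (φ a) = φ b) ↔ (a ≠ R.root ∧ R.parent a = b) := by
    intro a b
    rw [Ne, hiff]
    refine and_congr_right fun ha => ?_
    rw [(hstep a ha).2, hinj.eq_iff]
  refine ⟨⟨Equiv.ofBijective φ hbij, fun {a b} => ?_⟩⟩
  rw [Equiv.ofBijective_apply, Equiv.ofBijective_apply, S.adj_iff, R.adj_iff, hpar, hpar]

/-- The non-root vertices whose subtree has exactly `a` vertices. -/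
noncomputable def level (R : Rooting G) (a : ℕ) : Finset V :=
  (Finset.univ.erase R.root).filter fun v => R.weight v = a

variable {R : Rooting G}

theorem mem_level {a : ℕ} {v : V} : v ∈ R.level a ↔ v ≠ R.root ∧ R.weight v = a := by
  simp [level]

/-- The vertices lying in a subtree with exactly `a` vertices. -/
noncomputable def below (R : Rooting G) (a : ℕ) : Finset V :=
  (R.level a).biUnion fun v => Finset.univ.filter (R.IsDesc · v)

theorem mem_below {a : ℕ} {x : V} :
    x ∈ R.below a ↔ ∃ v, v ≠ R.root ∧ R.weight v = a ∧ R.IsDesc x v := by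
  simp [below, mem_level, and_assoc]

theorem root_notMem_below (a : ℕ) : R.root ∉ R.below a := by
  rw [mem_below]
  rintro ⟨v, hv, -, h⟩
  exact hv h.eq_root

theorem card_below (a : ℕ) : (R.below a).card = (R.level a).card * a := by
  rw [below, Finset.card_biUnion, Finset.sum_const_nat]
  · exact fun v hv => (mem_level.1 hv).2
  · intro u hu v hv hne
    refine Finset.disjoint_left.2 fun x hx hx' => ?_
    have hw : R.weight u = R.weight v := (mem_level.1 hu).2.trans (mem_level.1 hv).2.symm
    rcases IsDesc.total (Finset.mem_filter.1 hx).2 (Finset.mem_filter.1 hx').2 with h | h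
    · exact absurd hw (h.weight_lt hne).ne
    · exact absurd hw (h.weight_lt hne.symm).ne'

theorem mem_below_of_card {a : ℕ} (h : Fintype.card V = 1 + (R.level a).card * a) {x : V}
    (hx : x ≠ R.root) : x ∈ R.below a := by
  have hsub : R.below a ⊆ Finset.univ.erase R.root := fun y hy =>
    Finset.mem_erase.2 ⟨fun e => root_notMem_below a (e ▸ hy), Finset.mem_univ _⟩
  rw [Finset.eq_of_subset_of_card_le hsub]
  · simpa using hx
  · rw [Finset.card_erase_of_mem (Finset.mem_univ _), Finset.card_univ, card_below]
    omega

theorem mem_below_of_notMem_level {a b : ℕ} (hab : a < b)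
    (h : Fintype.card V = 1 + (R.level b).card + (R.level a).card * a) {x : V}
    (hx : x ≠ R.root) (hxb : R.weight x ≠ b) : x ∈ R.below a := by
  have hroot : R.root ∉ R.level b := fun h => (mem_level.1 h).1 rfl
  have hsub : R.below a ⊆ (insert R.root (R.level b))ᶜ := by
    intro y hy
    rw [Finset.mem_compl, Finset.mem_insert, not_or]
    refine ⟨fun e => root_notMem_below a (e ▸ hy), fun hyb => ?_⟩
    obtain ⟨v, -, hv, hd⟩ := mem_below.1 hy
    have := hd.weight_le
    have := (mem_level.1 hyb).2
    omega
  rw [Finset.eq_of_subset_of_card_le hsub]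
  · simp [mem_level, hx, hxb]
  · rw [Finset.card_compl, Finset.card_insert_of_notMem hroot, card_below]
    omega

theorem isPTETree_of_levels {n α : ℕ} (hn : 2 ≤ n) (hα : 0 < α)
    (hcard : Fintype.card V = 1 + n * (1 + 3 * α))
    (htop : (R.level (1 + 3 * α)).card = n) (hthree : (R.level 3).card = n * α) :
    IsPTETree G := by
  have cover_top : ∀ x, x ≠ R.root → x ∈ R.below (1 + 3 * α) := fun x hx =>
    mem_below_of_card (by rw [htop, hcard]) hx
  have cover_three : ∀ x, x ≠ R.root → R.weight x ≠ 1 + 3 * α → x ∈ R.below 3 := fun x hx hxw =>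
    mem_below_of_notMem_level (by omega) (by rw [htop, hthree, hcard]; ring) hx hxw
  have children_root : R.children R.root = R.level (1 + 3 * α) := by
    ext v
    rw [mem_children, mem_level]
    refine and_congr_right fun hv => ⟨fun hp => ?_, fun hw => by_contra fun hp => ?_⟩
    · obtain ⟨u, hu, huw, hd⟩ := mem_below.1 (cover_top v hv)
      rcases hd.eq_or_parent with rfl | ⟨-, hd⟩
      · exact huw
      · rw [hp] at hd
        exact absurd hd.eq_root hu
    · obtain ⟨u, hu, huw, hd⟩ := mem_below.1 (cover_top _ hp)
      have := hd.weight_le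
      have := weight_lt_weight_parent hv
      omega
  have weight_child : ∀ t ∈ R.level (1 + 3 * α), ∀ u ∈ R.children t, R.weight u = 3 := by
    intro t ht u hu
    rw [mem_level] at ht
    rw [mem_children] at hu
    have hlt := weight_lt_weight_parent hu.1
    rw [hu.2] at hlt
    obtain ⟨v, hv, hvw, hd⟩ := mem_below.1 (cover_three u hu.1 (by omega))
    rcases hd.eq_or_parent with rfl | ⟨-, hd⟩
    · exact hvw
    · have := hd.weight_le
      rw [hu.2] at this
      omega
  have card_children : ∀ t ∈ R.level (1 + 3 * α), (R.children t).card = α := by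
    intro t ht
    have h := R.weight_eq t
    rw [(mem_level.1 ht).2, Finset.sum_const_nat (weight_child t ht)] at h
    omega
  let IsPathTop : V → Prop := fun t => ∃ a ∈ R.children t, ∃ b, b ∈ R.children a
  have hpath : ∀ t, ∃ a b, IsPathTop t → a ∈ R.children t ∧ b ∈ R.children a := by
    intro t
    by_cases ht : IsPathTop t
    · obtain ⟨a, ha, b, hb⟩ := ht
      exact ⟨a, b, fun _ => ⟨ha, hb⟩⟩
    · exact ⟨t, t, fun h => absurd h ht⟩
  have hstar : ∀ t, ∃ a b, R.weight t = 3 → ¬ IsPathTop t →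
      a ≠ b ∧ a ∈ R.children t ∧ b ∈ R.children t := by
    intro t
    by_cases ht : R.weight t = 3 ∧ ¬ IsPathTop t
    · have hone : ∀ a ∈ R.children t, R.weight a = 1 := by
        intro a ha
        have : R.children a = ∅ := Finset.eq_empty_of_forall_notMem fun b hb => ht.2 ⟨a, ha, b, hb⟩
        rw [weight_eq, this, Finset.sum_empty, add_zero]
      have h := R.weight_eq t
      rw [ht.1, Finset.sum_const_nat hone] at h
      obtain ⟨a, b, hab, hch⟩ := Finset.card_eq_two.1 (show (R.children t).card = 2 by omega)
      exact ⟨a, b, fun _ _ => ⟨hab, by simp [hch], by simp [hch]⟩⟩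
    · exact ⟨t, t, fun h h' => absurd ⟨h, h'⟩ ht⟩
  choose x₁ x₂ hx using hpath
  choose y₁ y₂ hy using hstar
  let A : Fin n ≃ R.level (1 + 3 * α) := (Finset.equivFinOfCardEq htop).symm
  let p : Fin n → ℕ := fun i => ((R.children (A i)).filter IsPathTop).card
  have hp : ∀ i, p i ≤ α := fun i =>
    (Finset.card_filter_le _ _).trans (card_children _ (A i).2).le
  let B : ∀ i, Fin (p i) ≃ (R.children (A i)).filter IsPathTop := fun i =>
    (Finset.equivFinOfCardEq rfl).symm
  have hs : ∀ i, ((R.children (A i)).filter fun t => ¬ IsPathTop t).card = α - p i := by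
    intro i
    have h := Finset.card_filter_add_card_filter_not (s := R.children (A i)) IsPathTop
    rw [card_children _ (A i).2] at h
    exact Nat.eq_sub_of_add_eq' h
  let C : ∀ i, Fin (α - p i) ≃ (R.children (A i)).filter fun t => ¬ IsPathTop t := fun i =>
    (Finset.equivFinOfCardEq (hs i)).symm
  have hA : ∀ i, R.Step (A i) R.root := fun i =>
    mem_children.1 (by rw [children_root]; exact (A i).2)
  have hB : ∀ i j, R.Step (B i j) (A i) := fun i j =>
    mem_children.1 (Finset.mem_filter.1 (B i j).2).1
  have hC : ∀ i j, R.Step (C i j) (A i) := fun i j =>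
    mem_children.1 (Finset.mem_filter.1 (C i j).2).1
  have hBx : ∀ i j, R.Step (x₁ (B i j)) (B i j) ∧ R.Step (x₂ (B i j)) (x₁ (B i j)) := fun i j =>
    (hx _ (Finset.mem_filter.1 (B i j).2).2).imp mem_children.1 mem_children.1
  have hCy : ∀ i j, y₁ (C i j) ≠ y₂ (C i j) ∧ R.Step (y₁ (C i j)) (C i j) ∧
      R.Step (y₂ (C i j)) (C i j) := fun i j => by
    have hmem := Finset.mem_filter.1 (C i j).2
    exact (hy _ (weight_child _ (A i).2 _ hmem.1) hmem.2).imp_right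
      (And.imp mem_children.1 mem_children.1)
  have hBC : ∀ i j k, (B i j : V) ≠ C i k := fun i j k h =>
    (Finset.mem_filter.1 (C i k).2).2 (h ▸ (Finset.mem_filter.1 (B i j).2).2)
  let φ : Vtx n p (fun i => α - p i) → V := fun
    | Sum.inl _ => R.root
    | Sum.inr (Sum.inl i) => A i
    | Sum.inr (Sum.inr (Sum.inl ⟨i, j, 0⟩)) => B i j
    | Sum.inr (Sum.inr (Sum.inl ⟨i, j, 1⟩)) => x₁ (B i j)
    | Sum.inr (Sum.inr (Sum.inl ⟨i, j, 2⟩)) => x₂ (B i j)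
    | Sum.inr (Sum.inr (Sum.inr ⟨i, j, 0⟩)) => C i j
    | Sum.inr (Sum.inr (Sum.inr ⟨i, j, 1⟩)) => y₁ (C i j)
    | Sum.inr (Sum.inr (Sum.inr ⟨i, j, 2⟩)) => y₂ (C i j)
  refine ⟨n, α, p, hα, ⟨hn, hp⟩, (nonempty_iso_of_map (tpsRooting n p fun i => α - p i) R φ ?_ rfl
    ?_ ?_).map SimpleGraph.Iso.symm⟩
  · rw [card_vtx, hcard, Finset.sum_congr rfl fun i _ =>
      show 1 + 3 * (p i + (α - p i)) = 1 + 3 * α by rw [Nat.add_sub_cancel' (hp i)]]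
    simp
  · intro x hx
    rcases x with _ | i | ⟨i, j, l⟩ | ⟨i, j, l⟩
    · exact absurd rfl hx
    · exact hA i
    · fin_cases l
      · exact hB i j
      · exact (hBx i j).1
      · exact (hBx i j).2
    · fin_cases l
      · exact hC i j
      · exact (hCy i j).2.1
      · exact (hCy i j).2.2
  · intro x y hx hy hpar hφ
    change tpsParent x = tpsParent y at hpar
    rcases x with _ | i | ⟨i, j, l⟩ | ⟨i, j, l⟩
    · exact absurd rfl hx
    all_goals rcases y with _ | i' | ⟨i', j', l'⟩ | ⟨i', j', l'⟩
    all_goals try exact absurd rfl hy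
    all_goals (try fin_cases l) <;> (try fin_cases l') <;> simp [tpsParent] at hpar
    · rw [A.injective (Subtype.ext hφ)]
    · subst hpar
      rw [(B i).injective (Subtype.ext hφ)]
    iterate 4
      · obtain ⟨rfl, hpar⟩ := hpar
        simp_all
    · subst hpar
      exact absurd hφ (hBC i j j')
    · subst hpar
      exact absurd hφ.symm (hBC i j' j)
    · subst hpar
      rw [(C i).injective (Subtype.ext hφ)]
    · obtain ⟨rfl, hpar⟩ := hpar
      simp_all
    · obtain ⟨rfl, hpar⟩ := hpar
      obtain rfl : j = j' := by simpa using hpar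
      exact absurd hφ (hCy i j).1
    · obtain ⟨rfl, hpar⟩ := hpar
      obtain rfl : j = j' := by simpa using hpar
      exact absurd hφ.symm (hCy i j).1
    · obtain ⟨rfl, hpar⟩ := hpar
      simp_all

end Rooting

/-- The `U_1`-polynomial recognizes PTE-trees: if `T` is a PTE-tree and `T'` is a tree
with the same `U_1`-polynomial, then `T'` is also a PTE-tree. -/
theorem U1_recognizes_PTE_trees {V V' : Type} [Fintype V] [Fintype V']
    (G : SimpleGraph V) (G' : SimpleGraph V')
    (hG : IsPTETree G) (hG' : G'.IsTree)
    (h : UkPoly G 1 = UkPoly G' 1) : IsPTETree G' := by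
  obtain ⟨n, α, p, hα, ⟨hn, hp⟩, ⟨e⟩⟩ := hG
  unfold Ttree at e
  obtain ⟨R, hR⟩ := Rooting.exists_centroid hG'
  let S := tpsRooting n p fun i => α - p i
  have hsum : ∀ i, p i + (α - p i) = α := fun i => Nat.add_sub_cancel' (hp i)
  have hcard : Fintype.card V = 1 + n * (1 + 3 * α) := by
    rw [Fintype.card_congr e.toEquiv, card_vtx]
    simp [hsum]
  have hcount : ∀ a, S.weights.count a = n * (if 1 + 3 * α = a then 1 else 0) +
      (∑ i, p i * ((if 3 = a then 1 else 0) + (if 2 = a then 1 else 0) + (if 1 = a then 1 else 0))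
       + ∑ i, (α - p i) *
        ((if 3 = a then 1 else 0) + (if 1 = a then 1 else 0) + (if 1 = a then 1 else 0))) := by
    intro a
    rw [count_weights_tps]
    simp only [hsum, Finset.sum_add_distrib, Finset.sum_const, Finset.card_univ, Fintype.card_fin,
      smul_eq_mul]
  have hS : ∀ v, v ≠ (S.comap e).root → 2 * (S.comap e).weight v ≤ Fintype.card V := by
    intro v hv
    have hle : (S.comap e).weight v ≤ 1 + 3 * α := by
      rw [Rooting.weight_comap, tps_weight]
      have hv' : e v ≠ Sum.inl () := fun h => hv (by rw [← e.symm_apply_apply v, h]; rfl)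
      generalize e v = x at hv'
      rcases x with _ | i | ⟨i, j, l⟩ | ⟨i, j, l⟩
      · exact absurd rfl hv'
      · simp [tpsWeight, hsum]
      · fin_cases l <;> simp only [tpsWeight] <;> omega
      · fin_cases l <;> simp only [tpsWeight] <;> omega
    have := Nat.mul_le_mul_right (1 + 3 * α) hn
    omega
  obtain ⟨hcard', hweights⟩ := Rooting.weights_eq_of_UkPoly_eq (S.comap e) R hS hR h
  rw [Rooting.weights_comap] at hweights
  have hα' : 1 + 3 * α ≠ 3 := by omega
  refine Rooting.isPTETree_of_levels (R := R) hn hα (hcard' ▸ hcard) ?_ ?_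
  · rw [Rooting.level, ← Rooting.count_weights, ← hweights, hcount]
    have h1 : 1 ≠ 1 + 3 * α := by omega
    have h2 : 2 ≠ 1 + 3 * α := by omega
    simp only [h1, h2, hα'.symm, if_true, if_false, mul_one, mul_zero, add_zero,
      Finset.sum_const_zero]
  · rw [Rooting.level, ← Rooting.count_weights, ← hweights, hcount]
    simp [hα', ← Finset.sum_add_distrib, hsum]
end
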